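/- arXiv:1306.6534 — 2 statements merged into one kernel-verified Lean document; each statement's English description precedes it below -/
import Mathlib

section
/- The fundamental group of the space CF is isomorphic to Thompson's group F. -/
/-- The set `CF_n ⊆ ℝ^n`: nondecreasing tuples with `t_{i+2} - t_i ≥ 1`. -/
def CFset (n : ℕ) : Set (Fin n → ℝ) :=
  {t | Monotone t ∧ ∀ (i : ℕ) (h : i + 2 < n), 1 ≤ t ⟨i + 2, h⟩ - t ⟨i, by omega⟩}

/-- `CF_n` as a topological space (subspace of `ℝ^n`). -/
abbrev CFn (n : ℕ) := ↥(CFset n)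

/-- The disjoint union `⨿_{n ≥ 1} CF_n`. -/
abbrev PreCF := (n : ℕ) × CFn (n + 1)

/-- Duplication of the `i`-th entry of a tuple. -/
def dup {n : ℕ} (t : Fin (n + 1) → ℝ) (i : Fin (n + 1)) : Fin (n + 2) → ℝ :=
  Fin.insertNth i.castSucc (t i) t

/-- The identification: a tuple is related to the result of duplicating one of its
entries, whenever the duplicated tuple still lies in the relevant `CF_{n+1}`. -/
def CFrel : PreCF → PreCF → Prop := fun x y =>
  ∃ (i : Fin (x.1 + 1)) (h : dup (x.2 : Fin (x.1 + 1) → ℝ) i ∈ CFset (x.1 + 2)),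
    y = ⟨x.1 + 1, ⟨dup (x.2 : Fin (x.1 + 1) → ℝ) i, h⟩⟩

/-- Belk's space `CF`: the quotient of `⨿ CF_n` by the identifications. -/
abbrev CF := Quot CFrel

/-- A basepoint of `CF`: the one-point configuration `(1)`. -/
def CFbase : CF :=
  Quot.mk CFrel ⟨0, ⟨fun _ => 1, ⟨monotone_const, fun i h => absurd h (by omega)⟩⟩⟩

/-- The unit interval `[0,1]` as a topological space. -/
abbrev unitI := ↥(Set.Icc (0 : ℝ) 1)

/-- The group of self-homeomorphisms of `[0,1]`, with composition as multiplication. -/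
instance homeoGroup : Group (unitI ≃ₜ unitI) where
  mul f g := g.trans f
  one := Homeomorph.refl _
  inv := Homeomorph.symm
  mul_assoc a b c := Homeomorph.ext fun _ => rfl
  one_mul a := Homeomorph.ext fun _ => rfl
  mul_one a := Homeomorph.ext fun _ => rfl
  inv_mul_cancel a := Homeomorph.ext fun x => a.symm_apply_apply x

/-- A dyadic rational: a real of the form `a / 2 ^ b` with `a b : ℕ`. -/
def IsDyadic (x : ℝ) : Prop := ∃ a b : ℕ, x = (a : ℝ) / 2 ^ b

/-- A homeomorphism of `[0,1]` lies in Thompson's group `F` iff it is piecewise linear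
with finitely many breakpoints, all at dyadic rationals, and all slopes powers of `2`:
there is a partition `0 = x₀ < x₁ < ⋯ < x_k = 1` by dyadic rationals such that on each
`[x_{j-1}, x_j]` the map is affine with slope `2^m`, `m : ℤ`. -/
def IsThompsonF (f : unitI ≃ₜ unitI) : Prop :=
  ∃ (k : ℕ) (x : Fin (k + 1) → ℝ), x 0 = 0 ∧ x (Fin.last k) = 1 ∧ StrictMono x ∧
    (∀ j, IsDyadic (x j)) ∧
    ∀ j : Fin k, ∃ (m : ℤ) (c : ℝ), ∀ y : unitI,
      x j.castSucc ≤ (y : ℝ) → (y : ℝ) ≤ x j.succ → ((f y : ℝ)) = 2 ^ m * (y : ℝ) + c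


/-! ## Part 1: the algebra of Thompson words -/

/-- The elementary merging map: identity below `i`, slope `1/2` on `[i,i+2]`,
translation by `-1` above. -/
noncomputable def lam (i : ℕ) : ℝ ≃o ℝ where
  toFun t := max (min t ((t + i) / 2)) (t - 1)
  invFun t := min (max t (2 * t - i)) (t + 1)
  left_inv t := by
    simp only [max_def, min_def]
    grind
  right_inv t := by
    simp only [max_def, min_def]
    grind
  map_rel_iff' := by
    intro a b
    have hm : StrictMono (fun t : ℝ => max (min t ((t + i) / 2)) (t - 1)) := by
      intro a b h
      exact max_lt_max (min_lt_min h (by linarith)) (by linarith)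
    exact hm.le_iff_le

theorem lam_apply (i : ℕ) (t : ℝ) : lam i t = max (min t ((t + i) / 2)) (t - 1) := rfl
theorem lam_inv_apply (i : ℕ) (t : ℝ) : (lam i)⁻¹ t = min (max t (2 * t - i)) (t + 1) := rfl

theorem lam_low {i : ℕ} {t : ℝ} (h : t ≤ i) : lam i t = t := by
  rw [lam_apply, min_eq_left (by linarith), max_eq_left (by linarith)]

theorem lam_mid {i : ℕ} {t : ℝ} (h : (i:ℝ) ≤ t) (h' : t ≤ i + 2) : lam i t = (t + i) / 2 := by
  rw [lam_apply, min_eq_right (by linarith), max_eq_left (by linarith)]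

theorem lam_high {i : ℕ} {t : ℝ} (h : (i:ℝ) + 2 ≤ t) : lam i t = t - 1 := by
  rw [lam_apply, max_eq_right]
  exact (min_le_right _ _).trans (by linarith)

theorem lam_inv_low {i : ℕ} {t : ℝ} (h : t ≤ i) : (lam i)⁻¹ t = t := by
  rw [lam_inv_apply, max_eq_left (by linarith), min_eq_left (by linarith)]

theorem lam_inv_high {i : ℕ} {t : ℝ} (h : (i:ℝ) + 1 ≤ t) : (lam i)⁻¹ t = t + 1 := by
  rw [lam_inv_apply, min_eq_right]
  exact le_trans (by linarith) (le_max_right _ _)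

theorem lam_inv_expand (i : ℕ) {x y : ℝ} (h : x ≤ y) :
    y - x ≤ (lam i)⁻¹ y - (lam i)⁻¹ x := by
  rw [lam_inv_apply, lam_inv_apply]
  rw [le_sub_iff_add_le]
  refine le_min ?_ ?_
  · rcases le_total x (i:ℝ) with hx | hx
    · rw [max_eq_left (by linarith), min_eq_left (by linarith)]
      exact le_trans (by linarith) (le_max_left _ _)
    · have := min_le_left (max x (2*x-i)) (x+1)
      rw [max_eq_right (by linarith)] at *
      rw [max_eq_right (by linarith)]
      linarith
  · have := min_le_right (max x (2*x-i)) (x+1)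
    linarith

theorem lam_rel {i j : ℕ} (h : i < j) : lam j * lam i = lam i * lam (j + 1) := by
  have hij : (i:ℝ) + 1 ≤ j := by exact_mod_cast h
  ext t
  rw [RelIso.mul_apply, RelIso.mul_apply]
  have hc : ((j + 1 : ℕ) : ℝ) = j + 1 := by push_cast; ring
  rcases le_total t (j + 1 : ℝ) with h1 | h1
  · rw [lam_low (i := j + 1) (by rw [hc]; linarith), lam_low (i := j)]
    rw [lam_apply]
    exact max_le (by rcases le_total t (i:ℝ) with h2 | h2 <;> [refine (min_le_left _ _).trans ?_; refine (min_le_right _ _).trans ?_] <;> linarith) (by linarith)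
  · rw [lam_high (i := i) (t := t) (by linarith)]
    rcases le_total t (j + 3 : ℝ) with h2 | h2
    · rw [lam_mid (i := j) (by linarith) (by linarith), lam_mid (i := j + 1) (by rw [hc]; linarith) (by rw [hc]; linarith), hc, lam_high (by linarith)]
      ring
    · rw [lam_high (i := j) (by linarith), lam_high (i := j + 1) (by rw [hc]; linarith), lam_high (by linarith)]

/-- Validity of a word: starting with `n+1` strands, each letter names a strand. -/
def Valid : ℕ → List ℕ → Prop
  | _, [] => True
  | n, i :: w => i ≤ n ∧ Valid (n + 1) w

theorem Valid.append {n : ℕ} {w w' : List ℕ} (h : Valid n w) (h' : Valid (n + w.length) w') :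
    Valid n (w ++ w') := by
  induction w generalizing n with
  | nil => simpa using h'
  | cons i w ih =>
    refine ⟨h.1, ih h.2 ?_⟩
    rw [List.length_cons] at h'
    convert h' using 1
    omega

/-- The merging map of a word. -/
noncomputable def Lw : List ℕ → (ℝ ≃o ℝ)
  | [] => 1
  | i :: w => lam i * Lw w

theorem Lw_append (w w' : List ℕ) : Lw (w ++ w') = Lw w * Lw w' := by
  induction w with
  | nil => simp [Lw]
  | cons i w ih => simp [Lw, ih, mul_assoc]

theorem Lw_inv_expand (w : List ℕ) {x y : ℝ} (h : x ≤ y) :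
    y - x ≤ (Lw w)⁻¹ y - (Lw w)⁻¹ x := by
  induction w generalizing x y with
  | nil => simp [Lw]
  | cons i w ih =>
    simp only [Lw, mul_inv_rev, RelIso.mul_apply]
    have h1 := lam_inv_expand i h
    exact h1.trans (ih (by linarith))

section Words

variable {Γ : Type*} [Group Γ] (g : ℕ → ℕ → Γ)

/-- The element attached to a word starting at level `n`. -/
def Ew : ℕ → List ℕ → Γ
  | _, [] => 1
  | n, i :: w => g n i * Ew (n + 1) w

theorem Ew_append (n : ℕ) (w w' : List ℕ) :
    Ew g n (w ++ w') = Ew g n w * Ew g (n + w.length) w' := by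
  induction w generalizing n with
  | nil => simp [Ew]
  | cons i w ih =>
    simp only [List.cons_append, Ew, ih, List.length_cons, mul_assoc]
    rw [show n + 1 + w.length = n + (w.length + 1) by omega]


theorem Ew_ore
    (hg : ∀ n i j, i < j → j ≤ n → g n j * g (n + 1) i = g n i * g (n + 1) (j + 1))
    (v : List ℕ) : ∀ (n i : ℕ), Valid n v → i ≤ n → ∃ w' v' : List ℕ,
    Valid (n + v.length) w' ∧ Valid (n + 1) v' ∧ v.length + w'.length = 1 + v'.length ∧
    g n i * Ew g (n + 1) v' = Ew g n v * Ew g (n + v.length) w' := by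
  induction v with
  | nil =>
    intro n i _ hi
    exact ⟨[i], [], ⟨by simpa using hi, trivial⟩, trivial, by simp, by simp [Ew]⟩
  | cons j v ih =>
    intro n i hv hi
    have e1 : n + (j :: v).length = n + 1 + v.length := by simp; omega
    rw [e1]
    rcases lt_trichotomy j i with hji | hji | hji
    · obtain ⟨w', v', h1, h2, h3, h4⟩ := ih (n + 1) (i + 1) hv.2 (by omega)
      refine ⟨w', j :: v', h1, ⟨by omega, h2⟩, by simp; omega, ?_⟩
      simp only [Ew]
      rw [← mul_assoc, hg n j i hji hi, mul_assoc, h4, mul_assoc]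
    · subst hji
      exact ⟨[], v, trivial, hv.2, by simp; omega, by simp [Ew]⟩
    · obtain ⟨w', v', h1, h2, h3, h4⟩ := ih (n + 1) i hv.2 (by omega)
      refine ⟨w', (j + 1) :: v', h1, ⟨by have := hv.1; omega, h2⟩, by simp; omega, ?_⟩
      simp only [Ew]
      rw [← mul_assoc, ← hg n i j hji hv.1, mul_assoc, h4, mul_assoc]

/-- The set of fractions `E_w E_v⁻¹` from level `0` to level `n`. -/
def Tset (n : ℕ) : Set Γ := {a | ∃ w v : List ℕ, Valid 0 w ∧ Valid n v ∧
  w.length = n + v.length ∧ a = Ew g 0 w * (Ew g n v)⁻¹}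

theorem one_mem_Tset : (1 : Γ) ∈ Tset g 0 := ⟨[], [], trivial, trivial, rfl, by simp [Ew]⟩

theorem Tset_mul
    (hg : ∀ n i j, i < j → j ≤ n → g n j * g (n + 1) i = g n i * g (n + 1) (j + 1))
    {n i : ℕ} (hi : i ≤ n) {a : Γ} (ha : a ∈ Tset g n) :
    a * g n i ∈ Tset g (n + 1) := by
  obtain ⟨w, v, hw, hv, hl, rfl⟩ := ha
  obtain ⟨w', v', h1, h2, h3, h4⟩ := Ew_ore g hg v n i hv hi
  refine ⟨w ++ w', v', hw.append (by rw [hl]; simpa using h1), h2, by simp; omega, ?_⟩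
  rw [Ew_append, hl, Nat.zero_add]
  rw [eq_mul_inv_iff_mul_eq, mul_assoc, h4]
  group

theorem Tset_mul_inv {n i : ℕ} (hi : i ≤ n) {a : Γ} (ha : a ∈ Tset g (n + 1)) :
    a * (g n i)⁻¹ ∈ Tset g n := by
  obtain ⟨w, v, hw, hv, hl, rfl⟩ := ha
  refine ⟨w, i :: v, hw, ⟨hi, hv⟩, by simp; omega, ?_⟩
  simp [Ew, mul_assoc]

theorem Ew_move
    (hg : ∀ n i j, i < j → j ≤ n → g n j * g (n + 1) i = g n i * g (n + 1) (j + 1))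
    (w : List ℕ) : ∀ (n i : ℕ), Valid n w → i ≤ n →
    ((Lw w)⁻¹ ((i:ℝ) + 1) - (Lw w)⁻¹ (i:ℝ) = 1) ∨
    ∃ w' : List ℕ, Valid (n + 1) w' ∧ w'.length + 1 = w.length ∧
      Ew g n w = Ew g n (i :: w') ∧ Lw w = Lw (i :: w') := by
  induction w with
  | nil => intro n i _ _; left; simp [Lw]
  | cons j v ih =>
    intro n i hv hi
    rcases lt_trichotomy j i with hji | hji | hji
    · rcases ih (n + 1) (i + 1) hv.2 (by omega) with h | ⟨w', h1, h2, h3, h4⟩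
      · left
        have hij : (j:ℝ) + 1 ≤ i := by exact_mod_cast hji
        simp only [Lw, mul_inv_rev, RelIso.mul_apply]
        rw [lam_inv_high hij, lam_inv_high (by linarith)]
        simpa using h
      · right
        refine ⟨j :: w', ⟨by omega, h1⟩, by simp; omega, ?_, ?_⟩
        · simp only [Ew] at h3 ⊢
          rw [h3, ← mul_assoc, ← mul_assoc, hg n j i hji hi]
        · simp only [Lw] at h4 ⊢
          rw [h4, ← mul_assoc, ← mul_assoc, lam_rel hji]
    · subst hji
      exact Or.inr ⟨v, hv.2, rfl, rfl, rfl⟩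
    · rcases ih (n + 1) i hv.2 (by omega) with h | ⟨w', h1, h2, h3, h4⟩
      · left
        have hij : (i:ℝ) + 1 ≤ j := by exact_mod_cast hji
        simp only [Lw, mul_inv_rev, RelIso.mul_apply]
        rw [lam_inv_low hij, lam_inv_low (by linarith)]
        exact h
      · right
        refine ⟨(j + 1) :: w', ⟨by have := hv.1; omega, h1⟩, by simp; omega, ?_, ?_⟩
        · simp only [Ew] at h3 ⊢
          rw [h3, ← mul_assoc, ← mul_assoc, hg n i j hji hv.1]
        · simp only [Lw] at h4 ⊢
          rw [h4, ← mul_assoc, ← mul_assoc, lam_rel hji]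

theorem Ew_inj
    (hg : ∀ n i j, i < j → j ≤ n → g n j * g (n + 1) i = g n i * g (n + 1) (j + 1))
    (w : List ℕ) : ∀ (n : ℕ) (w' : List ℕ), Valid n w → Valid n w' →
    w.length = w'.length → Lw w = Lw w' → Ew g n w = Ew g n w' := by
  induction w with
  | nil =>
    intro n w' _ _ hl _
    rw [List.length_nil, eq_comm, List.length_eq_zero_iff] at hl
    rw [hl]
  | cons i v ih =>
    intro n w' hv hw' hl hL
    rcases Ew_move g hg w' n i hw' hv.1 with h | ⟨w'', h1, h2, h3, h4⟩
    · exfalso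
      rw [← hL] at h
      simp only [Lw, mul_inv_rev, RelIso.mul_apply] at h
      rw [lam_inv_low le_rfl, lam_inv_high le_rfl] at h
      have := Lw_inv_expand v (x := i) (y := i + 1 + 1) (by linarith)
      linarith
    · rw [h3]
      simp only [Ew]
      rw [ih (n + 1) w'' hv.2 h1 (by simp at hl; omega)]
      rw [h4] at hL
      simpa [Lw] using hL

end Words

/-! ## Part 2: words and piecewise linear homeomorphisms -/

open Classical in
/-- Extension of a homeomorphism of `[0,1]` by the identity. -/
noncomputable def extHom : (unitI ≃ₜ unitI) →* Equiv.Perm ℝ where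
  toFun f := Equiv.Perm.ofSubtype (p := fun x => x ∈ Set.Icc (0:ℝ) 1) f.toEquiv
  map_one' := map_one (Equiv.Perm.ofSubtype (p := fun x => x ∈ Set.Icc (0:ℝ) 1))
  map_mul' f g := map_mul (Equiv.Perm.ofSubtype (p := fun x => x ∈ Set.Icc (0:ℝ) 1))
    f.toEquiv g.toEquiv

theorem extHom_mem (f : unitI ≃ₜ unitI) {y : ℝ} (hy : y ∈ Set.Icc (0:ℝ) 1) :
    extHom f y = f ⟨y, hy⟩ := by
  classical
  exact Equiv.Perm.ofSubtype_apply_of_mem (p := fun x => x ∈ Set.Icc (0:ℝ) 1) f.toEquiv hy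

theorem extHom_not_mem (f : unitI ≃ₜ unitI) {y : ℝ} (hy : y ∉ Set.Icc (0:ℝ) 1) :
    extHom f y = y := by
  classical
  exact Equiv.Perm.ofSubtype_apply_of_not_mem (p := fun x => x ∈ Set.Icc (0:ℝ) 1) f.toEquiv hy

theorem extHom_injective : Function.Injective extHom := by
  intro f g h
  ext y
  rw [← extHom_mem f y.2, ← extHom_mem g y.2, h]

/-- Order automorphisms as permutations. -/
def permHom : (ℝ ≃o ℝ) →* Equiv.Perm ℝ where
  toFun σ := σ.toEquiv
  map_one' := rfl
  map_mul' _ _ := rfl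

theorem permHom_apply (σ : ℝ ≃o ℝ) (y : ℝ) : permHom σ y = σ y := rfl

theorem permHom_injective : Function.Injective permHom := by
  intro f g h
  ext y
  rw [← permHom_apply f, h, permHom_apply]

theorem Lw_low (w : List ℕ) {t : ℝ} (ht : t ≤ 0) : Lw w t = t := by
  induction w with
  | nil => rfl
  | cons i w ih =>
    simp only [Lw, RelIso.mul_apply, ih]
    exact lam_low (ht.trans (Nat.cast_nonneg _))

theorem Lw_high (w : List ℕ) : ∀ n, Valid n w → ∀ t : ℝ, (n:ℝ) + 1 + w.length ≤ t →
    Lw w t = t - w.length := by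
  induction w with
  | nil => intro n _ t _; simp [Lw]
  | cons i w ih =>
    intro n hw t ht
    simp only [List.length_cons, Nat.cast_add, Nat.cast_one] at ht ⊢
    simp only [Lw, RelIso.mul_apply]
    have hi : (i:ℝ) ≤ n := by exact_mod_cast hw.1
    rw [ih (n+1) hw.2 t (by push_cast; linarith), lam_high (by linarith)]
    ring

theorem lam_affine (i j : ℕ) : ∃ (k d : ℕ) (c : ℝ), ∀ t : ℝ, (j:ℝ) ≤ t → t ≤ j + 1 →
    lam i t = (1/2)^d * t + c ∧ (k:ℝ) ≤ lam i t ∧ lam i t ≤ k + 1 := by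
  rcases lt_or_ge j i with h | h
  · have h : (j:ℝ) + 1 ≤ i := by exact_mod_cast h
    refine ⟨j, 0, 0, fun t h1 h2 => ?_⟩
    rw [lam_low (by linarith)]
    exact ⟨by ring, h1, h2⟩
  · rcases lt_or_ge j (i + 2) with h' | h'
    · have h : (i:ℝ) ≤ j := by exact_mod_cast h
      have h' : (j:ℝ) + 1 ≤ i + 2 := by exact_mod_cast h'
      refine ⟨i, 1, i / 2, fun t h1 h2 => ?_⟩
      rw [lam_mid (by linarith) (by linarith)]
      exact ⟨by ring, by linarith, by linarith⟩
    · have h' : (i:ℝ) + 2 ≤ j := by exact_mod_cast h'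
      have h1j : ((j - 1 : ℕ) : ℝ) = j - 1 := by
        rw [Nat.cast_sub (by omega)]; simp
      refine ⟨j - 1, 0, -1, fun t h1 h2 => ?_⟩
      rw [lam_high (by linarith), h1j]
      exact ⟨by ring, by linarith, by linarith⟩

theorem Lw_affine (w : List ℕ) (j : ℕ) : ∃ (k d : ℕ) (c : ℝ), ∀ t : ℝ, (j:ℝ) ≤ t → t ≤ j + 1 →
    Lw w t = (1/2)^d * t + c ∧ (k:ℝ) ≤ Lw w t ∧ Lw w t ≤ k + 1 := by
  induction w with
  | nil => exact ⟨j, 0, 0, fun t h1 h2 => by simp [Lw, h1, h2]⟩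
  | cons i w ih =>
    obtain ⟨k, d, c, h⟩ := ih
    obtain ⟨k', d', c', h'⟩ := lam_affine i k
    refine ⟨k', d' + d, (1/2)^d' * c + c', fun t h1 h2 => ?_⟩
    obtain ⟨a1, a2, a3⟩ := h t h1 h2
    obtain ⟨b1, b2, b3⟩ := h' _ a2 a3
    simp only [Lw, RelIso.mul_apply]
    refine ⟨?_, b2, b3⟩
    rw [b1, a1]; ring

theorem IsDyadic.lam {t : ℝ} (ht : IsDyadic t) (i : ℕ) : IsDyadic (lam i t) := by
  obtain ⟨a, b, rfl⟩ := ht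
  have hb : (0:ℝ) < 2 ^ b := by positivity
  rcases le_total ((a:ℝ) / 2 ^ b) i with h | h
  · rw [lam_low h]; exact ⟨a, b, rfl⟩
  · rcases le_total ((a:ℝ) / 2 ^ b) (i + 2) with h' | h'
    · rw [lam_mid h h']
      refine ⟨a + i * 2 ^ b, b + 1, ?_⟩
      push_cast
      field_simp
      ring
    · rw [lam_high h']
      have : (2:ℝ) ^ b ≤ a := by
        rw [le_div_iff₀ hb] at h'
        have : (0:ℝ) ≤ i := Nat.cast_nonneg _
        nlinarith
      have h2 : 2 ^ b ≤ a := by exact_mod_cast this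
      refine ⟨a - 2 ^ b, b, ?_⟩
      rw [Nat.cast_sub h2]
      push_cast
      field_simp

theorem IsDyadic.Lw {t : ℝ} (ht : IsDyadic t) (w : List ℕ) : IsDyadic (Lw w t) := by
  induction w with
  | nil => exact ht
  | cons i w ih => exact ih.lam i

theorem frac_low (w v : List ℕ) {t : ℝ} (ht : t ≤ 0) : (Lw w * (Lw v)⁻¹) t = t := by
  rw [RelIso.mul_apply]
  have : (Lw v)⁻¹ t = t := by
    conv_lhs => rw [← Lw_low v ht]
    exact RelIso.inv_apply_self _ _
  rw [this, Lw_low w ht]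

theorem Lw_inv_high (v : List ℕ) (hv : Valid 0 v) {t : ℝ} (ht : 1 ≤ t) :
    (Lw v)⁻¹ t = t + v.length := by
  have : Lw v (t + v.length) = t := by
    rw [Lw_high v 0 hv _ (by simp; linarith)]; ring
  conv_lhs => rw [← this]
  exact RelIso.inv_apply_self _ _

theorem frac_high (w v : List ℕ) (hw : Valid 0 w) (hv : Valid 0 v) (hl : w.length = v.length)
    {t : ℝ} (ht : 1 ≤ t) : (Lw w * (Lw v)⁻¹) t = t := by
  rw [RelIso.mul_apply, Lw_inv_high v hv ht, Lw_high w 0 hw _ (by simp [hl]; linarith), hl]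
  ring

theorem frac_thompson (w v : List ℕ) (hw : Valid 0 w) (hv : Valid 0 v)
    (hl : w.length = v.length) : ∃ f : unitI ≃ₜ unitI, IsThompsonF f ∧
      extHom f = permHom (Lw w * (Lw v)⁻¹) := by
  set σ : ℝ ≃o ℝ := Lw w * (Lw v)⁻¹ with hσ
  have h0 : σ 0 = 0 := frac_low w v le_rfl
  have h1 : σ 1 = 1 := frac_high w v hw hv hl le_rfl
  have hmem : ∀ x, x ∈ Set.Icc (0:ℝ) 1 ↔ σ x ∈ Set.Icc (0:ℝ) 1 := by
    intro x
    constructor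
    · rintro ⟨a, b⟩
      exact ⟨h0 ▸ σ.monotone a, h1 ▸ σ.monotone b⟩
    · rintro ⟨a, b⟩
      rw [← h0] at a
      rw [← h1] at b
      exact ⟨σ.le_iff_le.1 a, σ.le_iff_le.1 b⟩
  let f : unitI ≃ₜ unitI := σ.toHomeomorph.subtype (p := fun x => x ∈ Set.Icc (0:ℝ) 1)
    (q := fun x => x ∈ Set.Icc (0:ℝ) 1) hmem
  have hf : ∀ y : unitI, ((f y : unitI) : ℝ) = σ y := fun y => rfl
  refine ⟨f, ?_, ?_⟩
  · refine ⟨v.length + 1, fun j => Lw v (j : ℕ), ?_, ?_, ?_, ?_, ?_⟩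
    · simp [Lw_low v le_rfl]
    · simp only [Fin.val_last]
      rw [Lw_high v 0 hv _ (by push_cast; linarith)]
      push_cast; ring
    · intro a b hab
      exact (Lw v).strictMono (by exact_mod_cast hab)
    · intro j
      exact IsDyadic.Lw ⟨j, 0, by simp⟩ v
    · intro j
      obtain ⟨k, d, c, h⟩ := Lw_affine w j
      obtain ⟨k', d', c', h'⟩ := Lw_affine v j
      refine ⟨(d':ℤ) - d, c - (1/2)^d * 2^d' * c', fun y hy1 hy2 => ?_⟩
      rw [hf]
      obtain ⟨t, ht⟩ : ∃ t, t = (Lw v)⁻¹ (y:ℝ) := ⟨_, rfl⟩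
      have hty : Lw v t = y := by rw [ht]; exact RelIso.apply_inv_self _ _
      have hs : σ y = Lw w t := by rw [ht]; rfl
      simp only [Fin.val_castSucc, Fin.val_succ] at hy1 hy2
      rw [← hty] at hy1 hy2
      have t1 := (Lw v).le_iff_le.1 hy1
      have t2 := (Lw v).le_iff_le.1 hy2
      push_cast at t2
      rw [hs, (h t t1 t2).1, ← hty, (h' t t1 t2).1, zpow_sub₀ (by norm_num)]
      simp only [zpow_natCast, one_div, inv_pow]
      field_simp
      ring
  · ext y
    rw [permHom_apply]
    by_cases hy : y ∈ Set.Icc (0:ℝ) 1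
    · rw [extHom_mem f hy, hf]
    · rw [extHom_not_mem f hy]
      rw [Set.mem_Icc, not_and_or, not_le, not_le] at hy
      rcases hy with hy | hy
      · exact (frac_low w v hy.le).symm
      · exact (frac_high w v hw hv hl hy.le).symm

/-- Two reals are the endpoints of a standard dyadic interval. -/
def StdDyadic (x y : ℝ) : Prop := ∃ a b : ℕ, x = a / 2 ^ b ∧ y = (a + 1) / 2 ^ b

theorem sibling_exp {A B a' b' : ℕ} (hA : A % 2 = 1) (hb : b' ≤ B)
    (h : (A:ℝ) / 2 ^ B = a' / 2 ^ b') : b' = B ∧ a' = A := by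
  have h1 : (A:ℝ) * 2 ^ b' = a' * 2 ^ B := by field_simp at h; linarith
  have h2 : A * 2 ^ b' = a' * 2 ^ B := by exact_mod_cast h1
  obtain ⟨d, rfl⟩ := Nat.exists_eq_add_of_le hb
  have h3 : A = a' * 2 ^ d := by
    have : A * 2 ^ b' = (a' * 2 ^ d) * 2 ^ b' := by rw [h2, pow_add]; ring
    exact Nat.eq_of_mul_eq_mul_right (by positivity) this
  rcases d with _ | d
  · simp at h3; exact ⟨rfl, h3.symm⟩
  · exfalso
    rw [h3, pow_succ, ← mul_assoc] at hA
    omega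

theorem find_siblings (K : ℕ) (y : ℕ → ℝ) (h0 : y 0 = 0) (h1 : y (K + 2) = 1)
    (hy : ∀ j, j ≤ K + 1 → StdDyadic (y j) (y (j + 1))) :
    ∃ i c B : ℕ, i ≤ K ∧ y i = c / 2 ^ B ∧ y (i + 2) = (c + 1) / 2 ^ B ∧
      y (i + 1) = (2 * c + 1) / 2 ^ (B + 1) := by
  choose! a b hab using hy
  obtain ⟨j, hj, hmax⟩ := Finset.exists_max_image (Finset.range (K + 2)) b ⟨0, by simp⟩
  simp only [Finset.mem_range] at hj hmax
  have hlt : ∀ k, k ≤ K + 1 → y k < y (k + 1) := by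
    intro k hk
    rw [(hab k hk).1, (hab k hk).2]
    gcongr
    linarith
  have hmono : ∀ k l, k < l → l ≤ K + 2 → y k < y l := by
    intro k l hkl
    induction l, hkl using Nat.le_induction with
    | base => intro h; exact hlt k (by omega)
    | succ l hl ih => intro h; exact (ih (by omega)).trans (hlt l (by omega))
  have hB : b j ≠ 0 := by
    intro hB
    have e1 := (hab j (by omega)).1
    have e2 := (hab j (by omega)).2
    rw [hB] at e1 e2
    simp only [pow_zero, div_one] at e1 e2
    rcases Nat.eq_zero_or_pos j with hj0 | hj0
    · have := hmono (j + 1) (K + 2) (by omega) le_rfl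
      rw [h1, e2] at this
      have : (0:ℝ) ≤ a j := Nat.cast_nonneg _
      linarith
    · have h2 := hmono 0 j hj0 (by omega)
      rw [h0, e1] at h2
      have h3 : 1 ≤ a j := by exact_mod_cast h2
      have h4 : (1:ℝ) ≤ a j := by exact_mod_cast h3
      have : y (j + 1) ≤ 1 := by
        rcases Nat.lt_or_ge (j + 1) (K + 2) with h | h
        · rw [← h1]; exact (hmono _ _ h le_rfl).le
        · rw [show j + 1 = K + 2 by omega, h1]
      linarith
  obtain ⟨B, hBB⟩ := Nat.exists_eq_succ_of_ne_zero hB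
  obtain ⟨e1, e2⟩ := hab j (by omega)
  rw [hBB] at e1 e2
  rcases Nat.mod_two_eq_zero_or_one (a j) with hp | hp
  · obtain ⟨c, hc⟩ : ∃ c, a j = 2 * c := ⟨a j / 2, by omega⟩
    rw [hc] at e1 e2
    have hjK : j ≠ K + 1 := by
      rintro rfl
      have : ((2 * c + 1 : ℕ) : ℝ) / 2 ^ (B + 1) = (1 : ℕ) / 2 ^ 0 := by
        rw [h1] at e2; push_cast at e2 ⊢; rw [← e2]; simp
      have := (sibling_exp (by omega) (by omega) this).1
      omega
    obtain ⟨f1, f2⟩ := hab (j + 1) (by omega)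
    have : ((2 * c + 1 : ℕ) : ℝ) / 2 ^ (B + 1) = a (j + 1) / 2 ^ b (j + 1) := by
      rw [← f1, e2]; push_cast; rfl
    have := sibling_exp (by omega) (by have := hmax (j + 1) (by omega); omega) this
    rw [this.1, this.2] at f2
    refine ⟨j, c, B, by omega, ?_, ?_, ?_⟩
    · rw [e1]; push_cast; rw [pow_succ]; field_simp
    · rw [f2]; push_cast; rw [pow_succ]; field_simp; ring
    · rw [e2]; push_cast; rfl
  · obtain ⟨c, hc⟩ : ∃ c, a j = 2 * c + 1 := ⟨a j / 2, by omega⟩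
    rw [hc] at e1 e2
    obtain ⟨j, rfl⟩ : ∃ j', j = j' + 1 := by
      rcases j with _ | j
      · exfalso
        rw [h0] at e1
        have : (0:ℝ) < ((2 * c + 1 : ℕ) : ℝ) / 2 ^ (B + 1) := by positivity
        exact absurd e1 this.ne
      · exact ⟨j, rfl⟩
    obtain ⟨f1, f2⟩ := hab j (by omega)
    have : ((2 * c + 1 : ℕ) : ℝ) / 2 ^ (B + 1) = (a j + 1 : ℕ) / 2 ^ b j := by
      rw [← e1, f2]; push_cast; rfl
    have := sibling_exp (by omega) (by have := hmax j (by omega); omega) this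
    have h4 : a j = 2 * c := by omega
    rw [this.1, h4] at f1
    refine ⟨j, c, B, by omega, ?_, ?_, ?_⟩
    · rw [f1]; push_cast; rw [pow_succ]; field_simp
    · rw [e2]; push_cast; rw [pow_succ]; field_simp; ring
    · rw [e1]; push_cast; rfl

theorem word_of_partition (K : ℕ) : ∀ (y : ℕ → ℝ), y 0 = 0 → y (K + 1) = 1 →
    (∀ j, j ≤ K → StdDyadic (y j) (y (j + 1))) →
    ∃ w : List ℕ, Valid 0 w ∧ w.length = K ∧ ∀ j : ℕ, j ≤ K → ∀ t : ℝ, (j:ℝ) ≤ t → t ≤ j + 1 →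
      Lw w t = y j + (t - j) * (y (j + 1) - y j) := by
  induction K with
  | zero =>
    intro y h0 h1 _
    refine ⟨[], trivial, rfl, fun j hj t _ _ => ?_⟩
    obtain rfl : j = 0 := by omega
    simp [Lw, h0, h1] at *
  | succ K ih =>
    intro y h0 h1 hy
    obtain ⟨i, c, B, hi, e1, e2, e3⟩ := find_siblings K y h0 h1 hy
    obtain ⟨w, hw, hl, hL⟩ := ih (fun k => if k ≤ i then y k else y (k + 1)) (by simp [h0])
      (by simp [show ¬ (K + 1 ≤ i) by omega, h1]) (by
        intro j hj
        rcases lt_trichotomy j i with h | h | h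
        · simp only [h.le, if_true, show j + 1 ≤ i by omega]
          exact hy j (by omega)
        · subst h
          simp only [le_refl, if_true, show ¬ (j + 1 ≤ j) by omega, if_false]
          exact ⟨c, B, e1, e2⟩
        · simp only [show ¬ (j ≤ i) by omega, if_false, show ¬ (j + 1 ≤ i) by omega]
          exact hy (j + 1) (by omega))
    refine ⟨w ++ [i], hw.append ⟨by omega, trivial⟩, by simp [hl], fun j hj t h1 h2 => ?_⟩
    rw [Lw_append]
    simp only [Lw, mul_one, RelIso.mul_apply]
    rcases Nat.lt_or_ge j i with h | h
    · have hji : (j:ℝ) + 1 ≤ i := by exact_mod_cast h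
      rw [lam_low (by linarith), hL j (by omega) t h1 h2]
      simp only [h.le, if_true, show j + 1 ≤ i by omega]
    · rcases Nat.lt_or_ge j (i + 2) with h' | h'
      · have a1 : (i:ℝ) ≤ j := by exact_mod_cast h
        have a2 : (j:ℝ) + 1 ≤ i + 2 := by exact_mod_cast h'
        rw [lam_mid (by linarith) (by linarith), hL i (by omega) _ (by linarith) (by linarith)]
        simp only [le_refl, if_true, show ¬ (i + 1 ≤ i) by omega, if_false]
        have hm : y (i + 1) = (y i + y (i + 2)) / 2 := by
          rw [e1, e2, e3, pow_succ]; field_simp; ring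
        obtain rfl | rfl : j = i ∨ j = i + 1 := by omega
        · rw [hm]; ring
        · rw [show i + 1 + 1 = i + 2 by omega, hm]; push_cast; ring
      · obtain ⟨j, rfl⟩ : ∃ j', j = j' + 1 := ⟨j - 1, by omega⟩
        have a1 : (i:ℝ) + 2 ≤ (j + 1 : ℕ) := by exact_mod_cast h'
        push_cast at h1 h2 a1
        rw [lam_high (by linarith), hL j (by omega) _ (by linarith) (by linarith)]
        simp only [show ¬ (j ≤ i) by omega, if_false, show ¬ (j + 1 ≤ i) by omega]
        push_cast; ring

open Filter in
theorem thompson_grid (f : unitI ≃ₜ unitI) (hf : IsThompsonF f) :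
    extHom f 0 = 0 ∧ extHom f 1 = 1 ∧ ∃ N : ℕ, ∀ j : ℕ, ((j:ℝ) + 1) / 2 ^ N ≤ 1 →
      StdDyadic (extHom f (j / 2 ^ N)) (extHom f ((j + 1) / 2 ^ N)) ∧
      ∀ y : ℝ, (j:ℝ) / 2 ^ N ≤ y → y ≤ ((j:ℝ) + 1) / 2 ^ N →
        extHom f y = extHom f (j / 2 ^ N) + (y - j / 2 ^ N) * 2 ^ N *
          (extHom f ((j + 1) / 2 ^ N) - extHom f (j / 2 ^ N)) := by
  obtain ⟨k, x, hx0, hx1, hxm, hxd, hxp⟩ := hf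
  set F : ℝ → ℝ := fun y => extHom f y with hF
  have hnn : ∀ y, 0 ≤ y → y ≤ 1 → 0 ≤ F y := by
    intro y h1 h2
    rw [hF]; simp only
    rw [extHom_mem f ⟨h1, h2⟩]; exact (f _).2.1
  have hx01 : ∀ p, 0 ≤ x p ∧ x p ≤ 1 := fun p =>
    ⟨hx0 ▸ hxm.monotone (Fin.zero_le p), hx1 ▸ hxm.monotone (Fin.le_last p)⟩
  have hxp' : ∀ j : Fin k, ∃ m : ℤ, ∀ y, x j.castSucc ≤ y → y ≤ x j.succ →
      F y = F (x j.castSucc) + 2 ^ m * (y - x j.castSucc) := by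
    intro j
    obtain ⟨m, c, h⟩ := hxp j
    refine ⟨m, ?_⟩
    have key : ∀ y, x j.castSucc ≤ y → y ≤ x j.succ → F y = 2 ^ m * y + c := by
      intro y h1 h2
      have hy : y ∈ Set.Icc (0:ℝ) 1 := ⟨(hx01 _).1.trans h1, h2.trans (hx01 _).2⟩
      rw [hF]; simp only
      rw [extHom_mem f hy]
      exact h ⟨y, hy⟩ h1 h2
    intro y h1 h2
    rw [key y h1 h2, key _ le_rfl (hxm.monotone (Fin.castSucc_lt_succ).le)]
    ring
  have hmono : ∀ p : Fin (k + 1), ∀ y y', 0 ≤ y → y ≤ y' → y' ≤ x p → F y ≤ F y' := by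
    intro p
    induction p using Fin.induction with
    | zero =>
      intro y y' h1 h2 h3
      rw [hx0] at h3
      rw [show y = y' by linarith]
    | succ p ih =>
      obtain ⟨m, hm⟩ := hxp' p
      have h2m : (0:ℝ) < 2 ^ m := by positivity
      have up : ∀ y y', x p.castSucc ≤ y → y ≤ y' → y' ≤ x p.succ → F y ≤ F y' := by
        intro y y' h1 h2 h3
        rw [hm y h1 (h2.trans h3), hm y' (h1.trans h2) h3]
        have := mul_le_mul_of_nonneg_left h2 h2m.le
        linarith
      intro y y' h1 h2 h3
      rcases le_total y' (x p.castSucc) with h | h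
      · exact ih y y' h1 h2 h
      · rcases le_total y (x p.castSucc) with h' | h'
        · exact (ih y _ h1 h' le_rfl).trans (up _ _ le_rfl h h3)
        · exact up y y' h' h2 h3
  have hmono1 : ∀ y y', 0 ≤ y → y ≤ y' → y' ≤ 1 → F y ≤ F y' := by
    have := hmono (Fin.last k); rwa [hx1] at this
  have hF0 : F 0 = 0 := by
    have h2 : F (f.symm ⟨0, by simp⟩ : unitI) = 0 := by
      rw [hF]; simp only
      rw [extHom_mem f (f.symm ⟨0, by simp⟩ : unitI).2]
      simp
    have := hmono1 0 _ le_rfl (f.symm ⟨0, by simp⟩ : unitI).2.1 (f.symm ⟨0, by simp⟩ : unitI).2.2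
    exact le_antisymm (this.trans h2.le) (hnn 0 le_rfl zero_le_one)
  have hF1 : F 1 = 1 := by
    have h2 : F (f.symm ⟨1, by simp⟩ : unitI) = 1 := by
      rw [hF]; simp only
      rw [extHom_mem f (f.symm ⟨1, by simp⟩ : unitI).2]
      simp
    have := hmono1 _ 1 (f.symm ⟨1, by simp⟩ : unitI).2.1 (f.symm ⟨1, by simp⟩ : unitI).2.2 le_rfl
    refine le_antisymm ?_ (h2.symm.le.trans this)
    rw [hF]; simp only
    rw [extHom_mem f ⟨zero_le_one, le_rfl⟩]; exact (f _).2.2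
  have hxE : ∀ p, ∀ᶠ N : ℕ in atTop, ∃ X : ℕ, x p * 2 ^ N = X := by
    intro p
    obtain ⟨a, b, h⟩ := hxd p
    filter_upwards [eventually_ge_atTop b] with N hN
    obtain ⟨d, rfl⟩ := Nat.exists_eq_add_of_le hN
    refine ⟨a * 2 ^ d, ?_⟩
    rw [h, pow_add]; push_cast; field_simp
  have hshift : ∀ m : ℤ, ∀ P : ℕ → Prop, (∀ᶠ N : ℕ in atTop, P N) →
      ∀ᶠ N : ℕ in atTop, ∃ b : ℕ, P b ∧ (2:ℝ) ^ m / 2 ^ N = 1 / 2 ^ b := by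
    intro m P hP
    obtain ⟨N0, hN0⟩ := eventually_atTop.1 hP
    filter_upwards [eventually_ge_atTop (N0 + m.natAbs)] with N hN
    refine ⟨(N - m).toNat, hN0 _ (by omega), ?_⟩
    have : (2:ℝ) ^ (N - m).toNat = 2 ^ ((N:ℤ) - m) := by
      rw [← zpow_natCast, Int.toNat_of_nonneg (by omega)]
    rw [this, zpow_sub₀ (by norm_num), zpow_natCast]
    field_simp
  have main : ∀ p : Fin (k + 1), ∀ᶠ N : ℕ in atTop, (∃ A : ℤ, F (x p) * 2 ^ N = A) ∧
      ∀ j : ℕ, ((j:ℝ) + 1) / 2 ^ N ≤ x p →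
      StdDyadic (F (j / 2 ^ N)) (F ((j + 1) / 2 ^ N)) ∧
      ∀ y : ℝ, (j:ℝ) / 2 ^ N ≤ y → y ≤ ((j:ℝ) + 1) / 2 ^ N →
        F y = F (j / 2 ^ N) + (y - j / 2 ^ N) * 2 ^ N *
          (F ((j + 1) / 2 ^ N) - F (j / 2 ^ N)) := by
    intro p
    induction p using Fin.induction with
    | zero =>
      refine Eventually.of_forall fun N => ⟨⟨0, by rw [hx0, hF0]; simp⟩, fun j hj => ?_⟩
      rw [hx0] at hj
      have : (0:ℝ) < ((j:ℝ) + 1) / 2 ^ N := by positivity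
      linarith
    | succ p ih =>
      obtain ⟨m, hm⟩ := hxp' p
      filter_upwards [ih, hxE p.castSucc, hxE p.succ,
        hshift m _ (ih.mono fun N h => h.1), hshift (-m) _ ((hxE p.castSucc).and (hxE p.succ))]
        with N h1 h2 h3 h4 h5
      obtain ⟨X, hX⟩ := h2
      obtain ⟨X', hX'⟩ := h3
      obtain ⟨b, ⟨A, hA⟩, hb⟩ := h4
      obtain ⟨A0, hA0⟩ := h1.1
      have hp := (hx01 p.castSucc).1
      have hp' := (hx01 p.succ).2
      have hN : (0:ℝ) < 2 ^ N := by positivity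
      have hbp : (0:ℝ) < 2 ^ b := by positivity
      have hxle : x p.castSucc ≤ x p.succ := hxm.monotone (Fin.castSucc_lt_succ).le
      have hm2 : (2:ℝ) ^ m * 2 ^ b = 2 ^ N := by field_simp at hb; linarith
      have hFx : F (x p.castSucc) = A / 2 ^ b := by field_simp; linarith
      have hxX : x p.castSucc = X / 2 ^ N := by field_simp; linarith
      have val : ∀ y, x p.castSucc ≤ y → y ≤ x p.succ →
          F y = (A + y * 2 ^ N - X) / 2 ^ b := by
        intro y ha hb
        rw [hm y ha hb, hFx, hxX]
        rw [← hm2]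
        have h2m : (2:ℝ) ^ m ≠ 0 := by positivity
        field_simp
        ring
      refine ⟨?_, fun j hj => ?_⟩
      · obtain ⟨b1, ⟨⟨Y, hY⟩, ⟨Y', hY'⟩⟩, hb1⟩ := h5
        refine ⟨A0 + Y' - Y, ?_⟩
        rw [zpow_neg] at hb1
        have e1 : (2:ℝ) ^ m * 2 ^ N = 2 ^ b1 := by
          have h2m : (2:ℝ) ^ m ≠ 0 := by positivity
          field_simp at hb1
          linarith
        rw [hm _ hxle le_rfl]
        push_cast
        rw [← hA0, ← hY, ← hY', ← e1]
        ring
      · rcases Nat.lt_or_ge j X with hjX | hjX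
        · refine h1.2 j (le_trans ?_ hxX.symm.le)
          gcongr
          exact_mod_cast hjX
        · have hjX' : (X:ℝ) ≤ j := by exact_mod_cast hjX
          have hj0 : x p.castSucc ≤ j / 2 ^ N := by rw [hxX]; gcongr
          have hj1 : (j:ℝ) / 2 ^ N ≤ (j + 1) / 2 ^ N := by gcongr; linarith
          have v0 := val _ hj0 (hj1.trans hj)
          have v1 := val _ (hj0.trans hj1) hj
          rw [div_mul_cancel₀ _ hN.ne'] at v0 v1
          have hpos := hnn _ (hp.trans hj0) ((hj1.trans hj).trans hp')
          have hpos' : (0:ℝ) ≤ A + j - X := by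
            rw [v0] at hpos
            by_contra hcon
            have := div_neg_of_neg_of_pos (not_le.1 hcon) hbp
            linarith
          have hpos'' : 0 ≤ A + j - X := by exact_mod_cast hpos'
          obtain ⟨B, hB⟩ := Int.eq_ofNat_of_zero_le hpos''
          have hB' : (A:ℝ) + j - X = B := by exact_mod_cast hB
          refine ⟨⟨B, b, ?_, ?_⟩, ?_⟩
          · rw [v0, hB']
          · rw [v1, ← hB']; ring
          · intro y ha hb'
            rw [val y (hj0.trans ha) (hb'.trans hj), v0, v1]
            field_simp
            ring
  refine ⟨hF0, hF1, ?_⟩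
  obtain ⟨N, hN⟩ := (main (Fin.last k)).exists
  rw [hx1] at hN
  exact ⟨N, hN.2⟩

theorem thompson_frac (f : unitI ≃ₜ unitI) (hf : IsThompsonF f) :
    ∃ w v : List ℕ, Valid 0 w ∧ Valid 0 v ∧ w.length = v.length ∧
      extHom f = permHom (Lw w * (Lw v)⁻¹) := by
  obtain ⟨h0, h1, N, hN⟩ := thompson_grid f hf
  obtain ⟨K, hK⟩ : ∃ K, 2 ^ N = K + 1 := ⟨2 ^ N - 1, by have := Nat.one_le_two_pow (n := N); omega⟩
  have hKr : (2:ℝ) ^ N = K + 1 := by exact_mod_cast hK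
  have hpos : (0:ℝ) < (K:ℝ) + 1 := by positivity
  rw [hKr] at hN
  have hle : ∀ j : ℕ, j ≤ K → ((j:ℝ) + 1) / (K + 1) ≤ 1 := by
    intro j hj
    rw [div_le_one hpos]
    have : (j:ℝ) ≤ K := by exact_mod_cast hj
    linarith
  obtain ⟨v, hv, hvl, hvL⟩ := word_of_partition K (fun j => (j:ℝ) / (K + 1)) (by simp)
    (by push_cast; exact div_self hpos.ne')
    (fun j hj => ⟨j, N, by rw [hKr], by rw [hKr]; push_cast; rfl⟩)
  obtain ⟨w, hw, hwl, hwL⟩ := word_of_partition K (fun j => extHom f ((j:ℝ) / (K + 1)))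
    (by simp [h0]) (by push_cast; rw [div_self hpos.ne', h1])
    (fun j hj => by push_cast; exact (hN j (hle j hj)).1)
  refine ⟨w, v, hw, hv, by omega, ?_⟩
  ext u
  rw [permHom_apply, RelIso.mul_apply]
  obtain ⟨t, ht⟩ : ∃ t, t = (Lw v)⁻¹ u := ⟨_, rfl⟩
  have htu : u = Lw v t := by rw [ht]; exact (RelIso.apply_inv_self _ _).symm
  rw [← ht, htu]
  rcases le_total t 0 with h | h
  · rw [Lw_low v h, Lw_low w h]
    rcases h.eq_or_lt with rfl | h
    · exact h0
    · exact extHom_not_mem f (fun hh => absurd hh.1 (not_le.2 h))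
  · rcases lt_or_ge t (K + 1 : ℝ) with h' | h'
    · have a1 := Nat.floor_le h
      have a2 := Nat.lt_floor_add_one t
      have a3 : ⌊t⌋₊ ≤ K := by
        have : (⌊t⌋₊ : ℝ) < (K + 1 : ℕ) := by push_cast; linarith
        have : ⌊t⌋₊ < K + 1 := by exact_mod_cast this
        omega
      rw [hwL _ a3 t a1 a2.le, hvL _ a3 t a1 a2.le]
      have a4 := hle _ a3
      generalize (⌊t⌋₊ : ℕ) = j at *
      push_cast
      rw [(hN j a4).2]
      · field_simp
        ring
      · rw [show (j:ℝ) / (K + 1) + (t - j) * ((j + 1) / (K + 1) - j / (K + 1)) = t / (K + 1) by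
          field_simp; ring]
        gcongr
      · rw [show (j:ℝ) / (K + 1) + (t - j) * ((j + 1) / (K + 1) - j / (K + 1)) = t / (K + 1) by
          field_simp; ring]
        gcongr
    · rw [Lw_high v 0 hv t (by rw [hvl]; push_cast; linarith),
        Lw_high w 0 hw t (by rw [hwl]; push_cast; linarith), hvl, hwl]
      rcases h'.eq_or_lt with h' | h'
      · rw [← h']; simp [h1]
      · exact extHom_not_mem f (fun hh => by have := hh.2; linarith)

/-! ## Part 3: the space `CF` -/

section Cells

/-- The value of a tuple at a natural number index (clamped). -/
def ht {n : ℕ} (t : Fin (n + 1) → ℝ) (k : ℕ) : ℝ := t ⟨min k n, by omega⟩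

theorem ht_of_le {n : ℕ} (t : Fin (n + 1) → ℝ) {k : ℕ} (h : k ≤ n) :
    ht t k = t ⟨k, by omega⟩ := by
  unfold ht; congr 2; omega

theorem dup_succAbove {n : ℕ} (t : Fin (n + 1) → ℝ) (i j : Fin (n + 1)) :
    dup t i (i.castSucc.succAbove j) = t j := by
  unfold dup; rw [Fin.insertNth_apply_succAbove]

theorem dup_apply_le {n : ℕ} (t : Fin (n + 1) → ℝ) (i : Fin (n + 1)) (k : Fin (n + 2))
    (h : (k : ℕ) ≤ i) : dup t i k = t ⟨k, by omega⟩ := by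
  rcases (Nat.lt_or_ge (k:ℕ) i) with h' | h'
  · have hj : i.castSucc.succAbove ⟨k, by omega⟩ = k := by
      rw [Fin.succAbove_of_castSucc_lt]
      · rfl
      · rw [Fin.lt_def]; exact h'
    exact (congrArg (dup t i) hj.symm).trans (dup_succAbove t i _)
  · obtain rfl : k = i.castSucc := by ext; simp; omega
    unfold dup
    rw [Fin.insertNth_apply_same]
    rfl

theorem dup_apply_gt {n : ℕ} (t : Fin (n + 1) → ℝ) (i : Fin (n + 1)) (k : Fin (n + 2))
    (h : (i : ℕ) < k) : dup t i k = t ⟨k - 1, by omega⟩ := by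
  have hj : i.castSucc.succAbove ⟨k - 1, by omega⟩ = k := by
    rw [Fin.succAbove_of_le_castSucc]
    · ext; simp; omega
    · rw [Fin.le_def]; simp; omega
  exact (congrArg (dup t i) hj.symm).trans (dup_succAbove t i _)

theorem ht_dup {n : ℕ} (t : Fin (n + 1) → ℝ) (i : Fin (n + 1)) (k : ℕ) :
    ht (dup t i) k = if k ≤ i then ht t k else ht t (k - 1) := by
  unfold ht
  split_ifs with h
  · rw [dup_apply_le _ _ _ (by simp; omega)]
    congr 2
    simp; omega
  · rw [dup_apply_gt _ _ _ (by simp; omega)]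
    congr 2
    simp; omega

theorem comp_dup {n : ℕ} (φ : ℝ → ℝ) (t : Fin (n + 1) → ℝ) (i : Fin (n + 1)) :
    φ ∘ dup t i = dup (φ ∘ t) i := by
  funext k
  rcases Nat.lt_or_ge (i:ℕ) k with h | h
  · simp only [Function.comp, dup_apply_gt _ _ _ h]
  · simp only [Function.comp, dup_apply_le _ _ _ h]

theorem range_dup {n : ℕ} (t : Fin (n + 1) → ℝ) (i : Fin (n + 1)) :
    Set.range (dup t i) = Set.range t := by
  apply Set.Subset.antisymm
  · rintro _ ⟨k, rfl⟩
    rcases Nat.lt_or_ge (i:ℕ) k with h | h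
    · rw [dup_apply_gt _ _ _ h]; exact ⟨_, rfl⟩
    · rw [dup_apply_le _ _ _ h]; exact ⟨_, rfl⟩
  · rintro _ ⟨k, rfl⟩
    exact ⟨i.castSucc.succAbove k, by unfold dup; rw [Fin.insertNth_apply_succAbove]⟩

theorem CFset.gap {n : ℕ} {t : Fin n → ℝ} (h : t ∈ CFset n) {a b : Fin n}
    (hab : (a:ℕ) + 2 ≤ b) : 1 ≤ t b - t a := by
  have h1 := h.2 a (by omega)
  have h2 : t ⟨a + 2, by omega⟩ ≤ t b := h.1 (by rw [Fin.le_def]; exact hab)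
  have h3 : t ⟨a, by omega⟩ = t a := rfl
  linarith

theorem CFset.of_gap {n : ℕ} {t : Fin n → ℝ} (hm : Monotone t)
    (h : ∀ a b : Fin n, (a:ℕ) + 2 ≤ b → 1 ≤ t b - t a) : t ∈ CFset n :=
  ⟨hm, fun i hi => h ⟨i, by omega⟩ ⟨i + 2, hi⟩ le_rfl⟩

/-- Product of the merging maps recorded by the coincidences of a sequence. -/
noncomputable def cc (u : ℕ → ℝ) : ℕ → (ℝ ≃o ℝ)
  | 0 => 1
  | k + 1 => cc u k * (if u k = u (k + 1) then lam k else 1)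

theorem cc_congr {u v : ℕ → ℝ} {n : ℕ} (h : ∀ k ≤ n, u k = v k) : cc u n = cc v n := by
  induction n with
  | zero => rfl
  | succ n ih =>
    simp only [cc]
    rw [ih (fun k hk => h k (by omega)), h n (by omega), h (n + 1) le_rfl]

theorem cc_dup (u : ℕ → ℝ) (i n : ℕ) (hi : i ≤ n) (hu : i < n → u i ≠ u (i + 1)) :
    cc (fun k => if k ≤ i then u k else u (k - 1)) (n + 1) = cc u n * lam i := by
  induction n, hi using Nat.le_induction with
  | base =>
    simp only [cc, le_refl, if_true, show ¬ (i + 1 ≤ i) by omega, if_false, Nat.add_sub_cancel]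
    congr 1
    exact cc_congr fun k hk => by simp [hk]
  | succ n hn ih =>
    rw [cc.eq_2 u n, cc.eq_2 _ (n + 1)]
    simp only [show ¬ (n + 1 ≤ i) by omega, show ¬ (n + 1 + 1 ≤ i) by omega, if_false,
      Nat.add_sub_cancel]
    generalize cc (fun k => if k ≤ i then u k else u (k - 1)) (n + 1) = C at *
    rcases hn.eq_or_lt with rfl | hn
    · have := hu (by omega)
      rw [if_neg this, if_neg this, mul_one, mul_one, ih (by omega)]
    · rw [ih (fun _ => hu (by omega))]
      split_ifs
      · rw [mul_assoc, mul_assoc, lam_rel hn]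
      · simp

/-- The merging map attached to a tuple. -/
noncomputable def cT {n : ℕ} (t : Fin (n + 1) → ℝ) : ℝ ≃o ℝ := cc (ht t) n

theorem dup_legal {n : ℕ} {t : Fin (n + 1) → ℝ} {i : Fin (n + 1)}
    (h : dup t i ∈ CFset (n + 2)) (hi : (i:ℕ) < n) : 1 ≤ ht t (i + 1) - ht t i := by
  have := CFset.gap h (a := ⟨i, by omega⟩) (b := ⟨i + 2, by omega⟩) le_rfl
  rw [dup_apply_gt _ _ _ (by simp), dup_apply_le _ _ _ (by simp)] at this
  rw [ht_of_le _ (by omega), ht_of_le _ (by omega)]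
  exact this

theorem cT_dup {n : ℕ} (t : Fin (n + 1) → ℝ) (i : Fin (n + 1))
    (h : dup t i ∈ CFset (n + 2)) : cT (dup t i) = cT t * lam i := by
  unfold cT
  rw [← cc_dup (ht t) i n (by omega)]
  · congr 1
    funext k
    exact ht_dup t i k
  · intro hi heq
    have := dup_legal h hi
    rw [heq] at this
    linarith

/-- The class of a tuple in `CF`. -/
def mk {n : ℕ} (t : Fin (n + 1) → ℝ) (h : t ∈ CFset (n + 1)) : CF := Quot.mk CFrel ⟨n, ⟨t, h⟩⟩

theorem CF_ind {motive : CF → Prop}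
    (h : ∀ {n : ℕ} (t : Fin (n + 1) → ℝ) (ht : t ∈ CFset (n + 1)), motive (mk t ht)) (x : CF) :
    motive x := by
  induction x using Quot.ind with
  | mk p => exact h p.2.1 p.2.2

theorem mk_dup {n : ℕ} (t : Fin (n + 1) → ℝ) (h : t ∈ CFset (n + 1)) (i : Fin (n + 1))
    (h' : dup t i ∈ CFset (n + 2)) : mk (dup t i) h' = mk t h :=
  (Quot.sound (r := CFrel) (a := ⟨n, ⟨t, h⟩⟩) ⟨i, h', rfl⟩).symm

theorem of_dup {n : ℕ} {t : Fin (n + 1) → ℝ} {i : Fin (n + 1)}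
    (h' : dup t i ∈ CFset (n + 2)) : t ∈ CFset (n + 1) := by
  have e : ∀ k, t k = dup t i (i.castSucc.succAbove k) := by
    intro k; unfold dup; rw [Fin.insertNth_apply_succAbove]
  have hm := Fin.strictMono_succAbove i.castSucc
  refine CFset.of_gap (fun a b hab => ?_) (fun a b hab => ?_)
  · rw [e, e]; exact h'.1 (hm.monotone hab)
  · rw [e, e]
    apply CFset.gap h'
    have h1 : i.castSucc.succAbove a < i.castSucc.succAbove ⟨a + 1, by omega⟩ :=
      hm (by rw [Fin.lt_def]; simp)
    have h2 : i.castSucc.succAbove ⟨a + 1, by omega⟩ < i.castSucc.succAbove b :=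
      hm (by rw [Fin.lt_def]; simp; omega)
    rw [Fin.lt_def] at h1 h2
    omega

theorem exists_strict : ∀ {n : ℕ} (t : Fin (n + 1) → ℝ) (h : t ∈ CFset (n + 1)),
    ∃ (m : ℕ) (t' : Fin (m + 1) → ℝ) (h' : t' ∈ CFset (m + 1)), StrictMono t' ∧
      Set.range t' = Set.range t ∧ mk t' h' = mk t h := by
  intro n
  induction n with
  | zero =>
    intro t h
    exact ⟨0, t, h, fun a b h => absurd h (by omega), rfl, rfl⟩
  | succ n ih =>
    intro t h
    by_cases hs : StrictMono t
    · exact ⟨_, t, h, hs, rfl, rfl⟩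
    · rw [Fin.strictMono_iff_lt_succ] at hs
      push Not at hs
      obtain ⟨i, hi⟩ := hs
      have hi' : t i.castSucc = t i.succ := le_antisymm (h.1 (Fin.castSucc_lt_succ).le) hi
      have hd : dup (Fin.removeNth i.castSucc t) i = t := by
        unfold dup
        conv_rhs => rw [← Fin.insertNth_self_removeNth i.castSucc t]
        congr 1
        simp [Fin.removeNth, hi']
      obtain ⟨t', rfl⟩ : ∃ t', dup t' i = t := ⟨_, hd⟩
      obtain ⟨m, s, hs, h1, h2, h3⟩ := ih t' (of_dup h)
      exact ⟨m, s, hs, h1, by rw [h2, range_dup], by rw [h3, mk_dup]⟩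

theorem mk_eq_of_range {n m : ℕ} {t : Fin (n + 1) → ℝ} {s : Fin (m + 1) → ℝ}
    (ht : t ∈ CFset (n + 1)) (hs : s ∈ CFset (m + 1)) (h : Set.range t = Set.range s) :
    mk t ht = mk s hs := by
  obtain ⟨a, t', ht', h1, h2, h3⟩ := exists_strict t ht
  obtain ⟨b, s', hs', k1, k2, k3⟩ := exists_strict s hs
  rw [← h3, ← k3]
  have hr : Set.range t' = Set.range s' := by rw [h2, k2, h]
  have hab : a = b := by
    have := congrArg Set.ncard hr
    rw [Set.ncard_range_of_injective h1.injective, Set.ncard_range_of_injective k1.injective] at this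
    simpa using this
  subst hab
  have := (StrictMono.range_inj h1 k1).1 hr
  subst this
  rfl

end Cells

section Nbhd

/-- Support of a configuration. -/
def supp : CF → Set ℝ := Quot.lift (fun p => Set.range p.2.1) (by
  rintro p _ ⟨i, h, rfl⟩
  exact (range_dup _ _).symm)

@[simp] theorem supp_mk {n : ℕ} (t : Fin (n + 1) → ℝ) (h : t ∈ CFset (n + 1)) :
    supp (mk t h) = Set.range t := rfl

theorem supp_finite (x : CF) : (supp x).Finite := by
  induction x using CF_ind with
  | h t ht => exact Set.finite_range _

theorem supp_injective : Function.Injective supp := by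
  intro x y h
  induction x using CF_ind with
  | h t ht =>
    induction y using CF_ind with
    | h s hs => exact mk_eq_of_range ht hs h

/-- Hausdorff closeness of subsets of the line. -/
def Close (ε : ℝ) (S R : Set ℝ) : Prop :=
  (∀ r ∈ R, ∃ s ∈ S, |r - s| < ε) ∧ (∀ s ∈ S, ∃ r ∈ R, |r - s| < ε)

theorem isOpen_CF {A : Set CF}
    (h : ∀ n : ℕ, IsOpen {t : CFn (n + 1) | mk t.1 t.2 ∈ A}) : IsOpen A := by
  rw [← isQuotientMap_quot_mk.isOpen_preimage, isOpen_sigma_iff]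
  exact h

theorem continuous_mk (n : ℕ) : Continuous (fun t : CFn (n + 1) => mk t.1 t.2) :=
  continuous_quot_mk.comp (continuous_sigmaMk (σ := fun n => CFn (n + 1)) (i := n))

theorem isOpen_close (ε : ℝ) {S : Set ℝ} (hS : S.Finite) : IsOpen {z | Close ε S (supp z)} := by
  apply isOpen_CF
  intro n
  have hc : ∀ (i : Fin (n + 1)) (s : ℝ), IsOpen {t : CFn (n + 1) | |t.1 i - s| < ε} :=
    fun i s => isOpen_lt (((continuous_apply i).comp continuous_subtype_val).sub continuous_const).abs
      continuous_const
  have : {t : CFn (n + 1) | mk t.1 t.2 ∈ {z | Close ε S (supp z)}} =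
      (⋂ i, ⋃ s ∈ S, {t : CFn (n + 1) | |t.1 i - s| < ε}) ∩
      (⋂ s ∈ S, ⋃ i, {t : CFn (n + 1) | |t.1 i - s| < ε}) := by
    ext t
    simp [Close]
  rw [this]
  refine IsOpen.inter (isOpen_iInter_of_finite fun i => isOpen_biUnion fun s _ => hc i s)
    (hS.isOpen_biInter fun s _ => isOpen_iUnion fun i => hc i s)

theorem exists_eps (x : CF) : ∃ ε : ℝ, 0 < ε ∧ 2 * ε ≤ 1 ∧
    ∀ s ∈ supp x, ∀ s' ∈ supp x, s < s' → 2 * ε ≤ s' - s ∧ (s' - s < 1 → s' - s + 2 * ε ≤ 1) := by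
  have key : ∀ a : ℝ, 0 < a → ∀ᶠ ε : ℝ in nhdsWithin 0 (Set.Ioi 0), 2 * ε ≤ a := by
    intro a ha
    filter_upwards [Ioo_mem_nhdsGT (show (0:ℝ) < a / 2 by linarith)] with ε hε
    have := hε.2
    linarith
  have h2 : ∀ᶠ ε : ℝ in nhdsWithin 0 (Set.Ioi 0), ∀ s ∈ supp x, ∀ s' ∈ supp x, s < s' →
      2 * ε ≤ s' - s ∧ (s' - s < 1 → s' - s + 2 * ε ≤ 1) := by
    rw [Filter.eventually_all_finite (supp_finite x)]
    intro s _
    rw [Filter.eventually_all_finite (supp_finite x)]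
    intro s' _
    rw [Filter.eventually_imp_distrib_left]
    intro hs
    refine (key _ (by linarith)).and ?_
    rw [Filter.eventually_imp_distrib_left]
    intro hs1
    filter_upwards [key (1 - (s' - s)) (by linarith)] with ε hε
    linarith
  obtain ⟨ε, h⟩ := ((self_mem_nhdsWithin (a := (0:ℝ)) (s := Set.Ioi 0)) |> fun h =>
    (Filter.Eventually.and h ((key 1 one_pos).and h2))).exists
  exact ⟨ε, h.1, h.2.1, h.2.2⟩

/-- Radius of the canonical neighbourhood. -/
noncomputable def eps (x : CF) : ℝ := (exists_eps x).choose

theorem eps_pos (x : CF) : 0 < eps x := (exists_eps x).choose_spec.1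
theorem eps_le (x : CF) : 2 * eps x ≤ 1 := (exists_eps x).choose_spec.2.1
theorem eps_spec {x : CF} {s s' : ℝ} (hs : s ∈ supp x) (hs' : s' ∈ supp x) (h : s < s') :
    2 * eps x ≤ s' - s ∧ (s' - s < 1 → s' - s + 2 * eps x ≤ 1) :=
  (exists_eps x).choose_spec.2.2 s hs s' hs' h

/-- The canonical neighbourhood. -/
def UU (x : CF) : Set CF := {y | Close (eps x) (supp x) (supp y)}

theorem isOpen_UU (x : CF) : IsOpen (UU x) := isOpen_close _ (supp_finite x)

theorem mem_UU_self (x : CF) : x ∈ UU x :=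
  ⟨fun r hr => ⟨r, hr, by simpa using eps_pos x⟩, fun r hr => ⟨r, hr, by simpa using eps_pos x⟩⟩

theorem near_unique {x : CF} {s s' r : ℝ} (hs : s ∈ supp x) (hs' : s' ∈ supp x)
    (h : |r - s| < eps x) (h' : |r - s'| < eps x) : s = s' := by
  rw [abs_lt] at h h'
  rcases lt_trichotomy s s' with hh | hh | hh
  · have := (eps_spec hs hs' hh).1; linarith
  · exact hh
  · have := (eps_spec hs' hs hh).1; linarith

open Classical in
/-- Nearest point of the support. -/
noncomputable def near (x : CF) (r : ℝ) : ℝ :=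
  if h : ∃ s ∈ supp x, |r - s| < eps x then h.choose else r

theorem near_eq {x : CF} {s r : ℝ} (hs : s ∈ supp x) (h : |r - s| < eps x) : near x r = s := by
  have hex : ∃ s ∈ supp x, |r - s| < eps x := ⟨s, hs, h⟩
  unfold near
  rw [dif_pos hex]
  exact near_unique hex.choose_spec.1 hs hex.choose_spec.2 h

theorem near_spec {x : CF} {r : ℝ} (hex : ∃ s ∈ supp x, |r - s| < eps x) :
    near x r ∈ supp x ∧ |r - near x r| < eps x := by
  unfold near
  rw [dif_pos hex]
  exact hex.choose_spec

theorem near_mem {n : ℕ} {t : Fin (n + 1) → ℝ} (h : t ∈ CFset (n + 1)) {x : CF}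
    (hx : mk t h ∈ UU x) : near x ∘ t ∈ CFset (n + 1) := by
  have hsp : ∀ i, near x (t i) ∈ supp x ∧ |t i - near x (t i)| < eps x :=
    fun i => near_spec (hx.1 _ ⟨i, rfl⟩)
  have hm : Monotone (near x ∘ t) := by
    intro i j hij
    by_contra hc
    rw [not_le] at hc
    have h1 := (eps_spec (hsp j).1 (hsp i).1 hc).1
    have h2 := h.1 hij
    have h3 := abs_lt.1 (hsp i).2
    have h4 := abs_lt.1 (hsp j).2
    linarith
  refine CFset.of_gap hm fun a b hab => ?_
  have h2 := CFset.gap h hab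
  have h3 := abs_lt.1 (hsp a).2
  have h4 := abs_lt.1 (hsp b).2
  have h5 : near x (t a) ≤ near x (t b) := hm (by rw [Fin.le_def]; omega)
  have h6 := eps_le x
  by_contra hc
  simp only [Function.comp] at hc
  rw [not_le] at hc
  rcases h5.eq_or_lt with h7 | h7
  · linarith
  · have := (eps_spec (hsp a).1 (hsp b).1 h7).2 hc
    linarith

theorem near_range {n : ℕ} {t : Fin (n + 1) → ℝ} (h : t ∈ CFset (n + 1)) {x : CF}
    (hx : mk t h ∈ UU x) : Set.range (near x ∘ t) = supp x := by
  apply Set.Subset.antisymm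
  · rintro _ ⟨i, rfl⟩
    exact (near_spec (hx.1 _ ⟨i, rfl⟩)).1
  · intro s hs
    obtain ⟨_, ⟨i, rfl⟩, hi⟩ := hx.2 s hs
    exact ⟨i, near_eq hs hi⟩

theorem near_mk {n : ℕ} {t : Fin (n + 1) → ℝ} (h : t ∈ CFset (n + 1)) {x : CF}
    (hx : mk t h ∈ UU x) : mk (near x ∘ t) (near_mem h hx) = x :=
  supp_injective (by rw [supp_mk, near_range h hx])

open Classical in
/-- The transition function. -/
noncomputable def hh (x : CF) : CF → (ℝ ≃o ℝ) :=
  Quot.lift (fun q => if Quot.mk CFrel q ∈ UU x then cT (near x ∘ q.2.1) * (cT q.2.1)⁻¹ else 1) (by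
    rintro ⟨n, t, ht⟩ _ ⟨i, h, rfl⟩
    have e : (Quot.mk CFrel ⟨n + 1, ⟨dup t i, h⟩⟩ : CF) = Quot.mk CFrel ⟨n, ⟨t, ht⟩⟩ :=
      mk_dup t ht i h
    simp only at h ⊢
    rw [e]
    split_ifs with hx
    · have hx' : mk (dup t i) h ∈ UU x := by rw [mk_dup t ht i h]; exact hx
      have h1 := near_mem h hx'
      rw [comp_dup] at h1 ⊢
      rw [cT_dup _ _ h1, cT_dup _ _ h]
      group
    · rfl)

theorem hh_mk {n : ℕ} {t : Fin (n + 1) → ℝ} (h : t ∈ CFset (n + 1)) {x : CF}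
    (hx : mk t h ∈ UU x) : hh x (mk t h) = cT (near x ∘ t) * (cT t)⁻¹ :=
  if_pos hx

theorem near_self {n : ℕ} {t : Fin (n + 1) → ℝ} (h : t ∈ CFset (n + 1)) :
    near (mk t h) ∘ t = t := by
  funext i
  exact near_eq (Set.mem_range_self i) (by simpa using eps_pos _)

theorem hh_self (x : CF) : hh x x = 1 := by
  induction x using CF_ind with
  | h t ht => rw [hh_mk ht (mem_UU_self _), near_self, mul_inv_cancel]

open Filter Topology in
theorem hh_local {x y : CF} (hxy : y ∈ UU x) :
    ∀ᶠ z in 𝓝 y, z ∈ UU x ∧ z ∈ UU y ∧ hh x z = hh x y * hh y z := by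
  obtain ⟨δ, hδ0, hδ1, hδ2⟩ : ∃ δ : ℝ, 0 < δ ∧ δ ≤ eps y ∧
      ∀ r ∈ supp y, δ + |r - near x r| ≤ eps x := by
    have key : ∀ a : ℝ, 0 < a → ∀ᶠ ε : ℝ in nhdsWithin 0 (Set.Ioi 0), ε ≤ a := by
      intro a ha
      filter_upwards [Ioo_mem_nhdsGT ha] with ε hε
      exact hε.2.le
    have h2 : ∀ᶠ δ : ℝ in nhdsWithin 0 (Set.Ioi 0), ∀ r ∈ supp y, δ + |r - near x r| ≤ eps x := by
      rw [Filter.eventually_all_finite (supp_finite y)]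
      intro r hr
      filter_upwards [key (eps x - |r - near x r|)
        (by have := (near_spec (hxy.1 r hr)).2; linarith)] with δ h
      linarith
    have h3 : ∀ᶠ δ : ℝ in nhdsWithin 0 (Set.Ioi 0), 0 < δ := self_mem_nhdsWithin
    obtain ⟨δ, h⟩ := (h3.and ((key _ (eps_pos y)).and h2)).exists
    exact ⟨δ, h.1, h.2.1, h.2.2⟩
  have hopen : ∀ᶠ z in 𝓝 y, Close δ (supp y) (supp z) :=
    (isOpen_close δ (supp_finite y)).mem_nhds
      ⟨fun r hr => ⟨r, hr, by simpa using hδ0⟩, fun r hr => ⟨r, hr, by simpa using hδ0⟩⟩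
  filter_upwards [hopen] with z hz
  have hzy : z ∈ UU y := by
    refine ⟨fun r hr => ?_, fun s hs => ?_⟩
    · obtain ⟨s, hs, h⟩ := hz.1 r hr; exact ⟨s, hs, h.trans_le hδ1⟩
    · obtain ⟨r, hr, h⟩ := hz.2 s hs; exact ⟨r, hr, h.trans_le hδ1⟩
  have step : ∀ q r, r ∈ supp y → |q - r| < δ → |q - near x r| < eps x := by
    intro q r hr h
    have := abs_sub_le q r (near x r)
    have := hδ2 r hr
    linarith
  have hzx : z ∈ UU x := by
    refine ⟨fun q hq => ?_, fun s hs => ?_⟩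
    · obtain ⟨r, hr, h⟩ := hz.1 q hq
      exact ⟨near x r, (near_spec (hxy.1 r hr)).1, step q r hr h⟩
    · obtain ⟨r, hr, h⟩ := hxy.2 s hs
      obtain ⟨q, hq, h'⟩ := hz.2 r hr
      have := step q r hr h'
      rw [near_eq hs h] at this
      exact ⟨q, hq, this⟩
  refine ⟨hzx, hzy, ?_⟩
  induction z using CF_ind with
  | h q hq =>
    have e1 := near_mk hq hzy
    have e2 : near x ∘ q = near x ∘ (near y ∘ q) := by
      funext i
      obtain ⟨r, hr, h⟩ := hz.1 (q i) ⟨i, rfl⟩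
      have e3 : near y (q i) = r := near_eq hr (h.trans_le hδ1)
      simp only [Function.comp, e3]
      exact near_eq (near_spec (hxy.1 r hr)).1 (step _ r hr h)
    rw [hh_mk hq hzx, hh_mk hq hzy, e2]
    have e4 : hh x y = cT (near x ∘ (near y ∘ q)) * (cT (near y ∘ q))⁻¹ := by
      have := hh_mk (x := x) (near_mem hq hzy) (by rw [e1]; exact hxy)
      rwa [e1] at this
    rw [e4]
    group

open Filter Topology in
theorem hh_cell {n : ℕ} (t : CFn (n + 1)) :
    ∀ᶠ t' : CFn (n + 1) in 𝓝 t, hh (mk t.1 t.2) (mk t'.1 t'.2) = cT t.1 * (cT t'.1)⁻¹ := by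
  have h1 : ∀ᶠ t' : CFn (n + 1) in 𝓝 t, ∀ i, |t'.1 i - t.1 i| < eps (mk t.1 t.2) := by
    rw [eventually_all]
    intro i
    have hc : Continuous fun t' : CFn (n + 1) => |t'.1 i - t.1 i| :=
      (((continuous_apply i).comp continuous_subtype_val).sub continuous_const).abs
    exact hc.continuousAt.eventually_lt_const (by simpa using eps_pos _)
  filter_upwards [h1] with t' ht'
  have hU : mk t'.1 t'.2 ∈ UU (mk t.1 t.2) := by
    constructor
    · rintro _ ⟨i, rfl⟩; exact ⟨_, ⟨i, rfl⟩, ht' i⟩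
    · rintro _ ⟨i, rfl⟩; exact ⟨_, ⟨i, rfl⟩, ht' i⟩
  rw [hh_mk t'.2 hU]
  congr 2
  funext i
  exact near_eq ⟨i, rfl⟩ (ht' i)

end Nbhd

/-! ## Part 4: the covering space and monodromy -/

section Cover

open Filter Topology Bundle

instance orderIsoTopology : TopologicalSpace (ℝ ≃o ℝ) := ⊥
instance orderIsoDiscrete : DiscreteTopology (ℝ ≃o ℝ) := ⟨rfl⟩

/-- The bundle of merging maps over `CF`. -/
noncomputable def ZZ : FiberBundleCore CF CF (ℝ ≃o ℝ) where
  baseSet := UU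
  isOpen_baseSet := isOpen_UU
  indexAt := id
  mem_baseSet_at := mem_UU_self
  coordChange i j z v := hh j z * (hh i z)⁻¹ * v
  coordChange_self i z _ v := by simp
  continuousOn_coordChange i j := by
    rintro ⟨z0, v0⟩ ⟨⟨hi, hj⟩, -⟩
    apply ContinuousAt.continuousWithinAt
    have h1 := (hh_local hi).and (hh_local hj)
    have h2 : ∀ᶠ v in 𝓝 v0, v = v0 := by
      rw [nhds_discrete]; exact eventually_pure.2 rfl
    have h3 := h1.prod_nhds h2
    refine (continuousAt_const (y := hh j z0 * (hh i z0)⁻¹ * v0)).congr ?_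
    filter_upwards [h3] with p hp
    obtain ⟨⟨a, b⟩, c⟩ := hp
    rw [c, a.2.2, b.2.2]
    group
  coordChange_comp i j k z _ v := by group

/-- The covering map. -/
theorem ZZ_cov : IsCoveringMap (π (ℝ ≃o ℝ) ZZ.Fiber) := FiberBundle.isCoveringMap

/-- Fibre coordinate. -/
noncomputable def fval (e : TotalSpace (ℝ ≃o ℝ) ZZ.Fiber) : ℝ ≃o ℝ := e.2

/-- A point of the total space. -/
noncomputable def fpt (x : CF) (v : ℝ ≃o ℝ) : TotalSpace (ℝ ≃o ℝ) ZZ.Fiber := ⟨x, v⟩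

theorem continuousAt_ZZ {A : Type*} [TopologicalSpace A] (f : A → TotalSpace (ℝ ≃o ℝ) ZZ.Fiber)
    (a : A) : ContinuousAt f a ↔ ContinuousAt (fun z => (f z).proj) a ∧
      ∀ᶠ z in 𝓝 a, hh (f a).proj (f z).proj * fval (f z) = fval (f a) := by
  rw [FiberBundle.continuousAt_totalSpace]
  refine and_congr_right fun _ => ?_
  have : ∀ z, ((trivializationAt (ℝ ≃o ℝ) ZZ.Fiber (f a).proj) (f z)).2 =
      hh (f a).proj (f z).proj * fval (f z) := by
    intro z
    change hh (f a).proj (f z).proj * (hh (f z).proj (f z).proj)⁻¹ * fval (f z) = _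
    rw [hh_self]
    simp
  simp only [this]
  rw [ContinuousAt, hh_self, one_mul, nhds_discrete (ℝ ≃o ℝ), tendsto_pure]

/-- Flat sections along a path. -/
def Flat {x y : CF} (γ : Path x y) (v : unitInterval → (ℝ ≃o ℝ)) : Prop :=
  ∀ s, ∀ᶠ s' in 𝓝 s, hh (γ s) (γ s') * v s' = v s

/-- Monodromy on fibres. -/
noncomputable def mon {x y : CF} (q : Path.Homotopic.Quotient x y) (v : ℝ ≃o ℝ) : ℝ ≃o ℝ :=
  (ZZ_cov.monodromy q ⟨⟨x, v⟩, rfl⟩).1.2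

theorem mon_spec {x y : CF} (q : Path.Homotopic.Quotient x y) (v : ℝ ≃o ℝ) :
    ZZ_cov.monodromy q ⟨⟨x, v⟩, rfl⟩ = ⟨⟨y, mon q v⟩, rfl⟩ := by
  unfold mon
  obtain ⟨⟨a, b⟩, h⟩ := ZZ_cov.monodromy q ⟨⟨x, v⟩, rfl⟩
  obtain rfl : a = y := h
  rfl

theorem mon_trans {x y z : CF} (q : Path.Homotopic.Quotient x y)
    (q' : Path.Homotopic.Quotient y z) (v : ℝ ≃o ℝ) : mon (q.trans q') v = mon q' (mon q v) := by
  have := mon_spec (q.trans q') v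
  rw [IsCoveringMap.monodromy_trans_apply, mon_spec q v, mon_spec q'] at this
  have h2 := congrArg (fun e : (π (ℝ ≃o ℝ) ZZ.Fiber) ⁻¹' {z} => (e.1.2 : ℝ ≃o ℝ)) this
  exact h2.symm

theorem mon_refl (x : CF) (v : ℝ ≃o ℝ) : mon (.refl x) v = v := by
  unfold mon
  rw [IsCoveringMap.monodromy_refl]
  rfl

theorem mon_of_flat {x y : CF} {γ : Path x y} {v : unitInterval → (ℝ ≃o ℝ)} (h : Flat γ v) :
    mon (.mk γ) (v 0) = v 1 := by
  let f : unitInterval → TotalSpace (ℝ ≃o ℝ) ZZ.Fiber := fun s => fpt (γ s) (v s)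
  have hf : Continuous f := by
    rw [continuous_iff_continuousAt]
    intro s
    rw [continuousAt_ZZ]
    exact ⟨γ.continuous.continuousAt, h s⟩
  let Γ : Path (fpt x (v 0)) (fpt y (v 1)) :=
    ⟨⟨f, hf⟩, congrArg (fun z => fpt z (v 0)) γ.source,
      congrArg (fun z => fpt z (v 1)) γ.target⟩
  have := ZZ_cov.monodromy_map (.mk Γ)
  have h2 := congrArg (fun e : (π (ℝ ≃o ℝ) ZZ.Fiber) ⁻¹' {y} => (e.1.2 : ℝ ≃o ℝ)) this
  exact h2

theorem exists_flat {x y : CF} (γ : Path x y) (v0 : ℝ ≃o ℝ) :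
    ∃ v, Flat γ v ∧ v 0 = v0 := by
  have h0 : γ 0 = (π (ℝ ≃o ℝ) ZZ.Fiber) ⟨x, v0⟩ := γ.source
  let Γ := ZZ_cov.liftPath γ ⟨x, v0⟩ h0
  have hl : ∀ s, (Γ s).proj = γ s := fun s => congrFun (ZZ_cov.liftPath_lifts γ ⟨x, v0⟩ h0) s
  have hz : Γ 0 = ⟨x, v0⟩ := ZZ_cov.liftPath_zero γ ⟨x, v0⟩ h0
  refine ⟨fun s => fval (Γ s), fun s => ?_, ?_⟩
  · have := ((continuousAt_ZZ Γ s).1 Γ.continuous.continuousAt).2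
    simpa only [hl] using this
  · exact congrArg (fun e : TotalSpace (ℝ ≃o ℝ) ZZ.Fiber => (e.2 : ℝ ≃o ℝ)) hz

theorem mon_mul {x y : CF} (q : Path.Homotopic.Quotient x y) (v a : ℝ ≃o ℝ) :
    mon q (v * a) = mon q v * a := by
  induction q using Path.Homotopic.Quotient.ind with
  | mk γ =>
    obtain ⟨w, hw, rfl⟩ := exists_flat γ v
    have hw' : Flat γ (fun s => w s * a) := by
      intro s
      filter_upwards [hw s] with s' h
      rw [← mul_assoc, h]
    have h1 := mon_of_flat hw'
    beta_reduce at h1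
    rw [h1, mon_of_flat hw]

/-- The holonomy of a class of paths. -/
noncomputable def hol {x y : CF} (q : Path.Homotopic.Quotient x y) : ℝ ≃o ℝ := mon q 1

theorem hol_refl (x : CF) : hol (.refl x) = 1 := mon_refl x 1

theorem hol_trans {x y z : CF} (q : Path.Homotopic.Quotient x y)
    (q' : Path.Homotopic.Quotient y z) : hol (q.trans q') = hol q' * hol q := by
  unfold hol
  rw [mon_trans, ← mon_mul, one_mul]

theorem hol_of_flat {x y : CF} {γ : Path x y} {v : unitInterval → (ℝ ≃o ℝ)} (h : Flat γ v) :
    hol (.mk γ) = v 1 * (v 0)⁻¹ := by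
  rw [← mon_of_flat h, eq_mul_inv_iff_mul_eq, hol, ← mon_mul, one_mul]

end Cover

section Segments
open Filter Topology unitInterval

theorem CFset_convex (n : ℕ) : Convex ℝ (CFset n) := by
  rintro t ⟨ht1, ht2⟩ u ⟨hu1, hu2⟩ a b ha hb hab
  refine ⟨fun i j hij => ?_, fun i h => ?_⟩
  · have h1 := mul_le_mul_of_nonneg_left (ht1 hij) ha
    have h2 := mul_le_mul_of_nonneg_left (hu1 hij) hb
    simpa using add_le_add h1 h2
  · have h1 := mul_le_mul_of_nonneg_left (ht2 i h) ha
    have h2 := mul_le_mul_of_nonneg_left (hu2 i h) hb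
    simp only [Pi.add_apply, Pi.smul_apply, smul_eq_mul]
    linarith

/-- Points of a segment in a cell. -/
def segPt {n : ℕ} (t u : CFn (n + 1)) (s : I) : CFn (n + 1) :=
  ⟨(1 - (s:ℝ)) • t.1 + (s:ℝ) • u.1,
    CFset_convex _ t.2 u.2 (by linarith [s.2.2]) s.2.1 (by ring)⟩

theorem continuous_segPt {n : ℕ} :
    Continuous fun p : CFn (n + 1) × CFn (n + 1) × I => segPt p.1 p.2.1 p.2.2 := by
  unfold segPt
  fun_prop

/-- The segment as a path. -/
def seg {n : ℕ} (t u : CFn (n + 1)) : Path t u where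
  toFun s := segPt t u s
  continuous_toFun := continuous_segPt.comp (by fun_prop : Continuous fun s : I => (t, u, s))
  source' := Subtype.ext (by simp [segPt])
  target' := Subtype.ext (by simp [segPt])

/-- The projection of a cell to `CF`. -/
def mkS {n : ℕ} (t : CFn (n + 1)) : CF := mk t.1 t.2

theorem continuous_mkS {n : ℕ} : Continuous (mkS (n := n)) := continuous_mk n

/-- The segment in `CF`. -/
def segF {n : ℕ} (t u : CFn (n + 1)) : Path (mkS t) (mkS u) := (seg t u).map continuous_mkS

theorem segF_apply {n : ℕ} (t u : CFn (n + 1)) (s : I) : segF t u s = mkS (segPt t u s) := rfl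

theorem segF_trans {n : ℕ} (t u v : CFn (n + 1)) :
    ((segF t u).trans (segF u v)).Homotopic (segF t v) := by
  have : ContractibleSpace (CFn (n + 1)) := (CFset_convex (n + 1)).contractibleSpace ⟨t.1, t.2⟩
  have h : ((seg t u).trans (seg u v)).Homotopic (seg t v) :=
    SimplyConnectedSpace.paths_homotopic _ _
  have := h.map (ContinuousMap.mk mkS continuous_mkS)
  rw [Path.map_trans] at this
  exact this

theorem segF_self {n : ℕ} (t : CFn (n + 1)) : segF t t = Path.refl _ := by
  ext s
  rw [segF_apply]
  have : segPt t t s = t := Subtype.ext (by simp [segPt, ← add_smul])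
  rw [this]; rfl

/-- Standard tuples. -/
def pp (n : ℕ) : CFn (n + 1) := ⟨fun k => 2 * ((k : ℕ) : ℝ) + 1, by
  refine ⟨fun i j hij => ?_, fun i h => ?_⟩
  · have : ((i : ℕ) : ℝ) ≤ (j : ℕ) := by exact_mod_cast hij
    linarith
  · push_cast; linarith⟩

theorem pp_zero : mkS (pp 0) = CFbase := by
  unfold mkS _root_.mk CFbase pp
  congr 3
  funext k
  have : (k : ℕ) = 0 := by omega
  simp [this]

theorem dup_mem {n : ℕ} {t : Fin (n + 1) → ℝ} (h : t ∈ CFset (n + 1)) (i : Fin (n + 1))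
    (h1 : ∀ a b : Fin (n + 1), (a : ℕ) + 1 = b → (i : ℕ) = a ∨ (i : ℕ) = b →  1 ≤ t b - t a) :
    dup t i ∈ CFset (n + 2) := by
  apply CFset.of_gap
  · intro a b hab
    rw [Fin.le_def] at hab
    rcases Nat.lt_or_ge (i:ℕ) a with ha | ha <;> rcases Nat.lt_or_ge (i:ℕ) b with hb | hb
    · rw [dup_apply_gt _ _ _ ha, dup_apply_gt _ _ _ hb]
      apply h.1; rw [Fin.le_def]; dsimp; omega
    · omega
    · rw [dup_apply_le _ _ _ ha, dup_apply_gt _ _ _ hb]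
      apply h.1; rw [Fin.le_def]; dsimp; omega
    · rw [dup_apply_le _ _ _ ha, dup_apply_le _ _ _ hb]
      apply h.1; rw [Fin.le_def]; dsimp; omega
  · intro a b hab
    rcases Nat.lt_or_ge (i:ℕ) a with ha | ha <;> rcases Nat.lt_or_ge (i:ℕ) b with hb | hb
    · rw [dup_apply_gt _ _ _ ha, dup_apply_gt _ _ _ hb]
      apply CFset.gap h; dsimp; omega
    · omega
    · rw [dup_apply_le _ _ _ ha, dup_apply_gt _ _ _ hb]
      by_cases hc : (a:ℕ) + 2 ≤ b - 1
      · apply CFset.gap h; dsimp; omega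
      · apply h1
        · dsimp; omega
        · dsimp; omega
    · rw [dup_apply_le _ _ _ ha, dup_apply_le _ _ _ hb]
      apply CFset.gap h; dsimp; omega

theorem dup_pp (n : ℕ) (i : Fin (n + 1)) : dup (pp n).1 i ∈ CFset (n + 2) := by
  apply dup_mem (pp n).2
  intro a b hab _
  have : ((a : ℕ) : ℝ) + 1 = (b : ℕ) := by exact_mod_cast hab
  dsimp [pp]; linarith

theorem mkS_dup {n : ℕ} (t : CFn (n + 1)) (i : Fin (n + 1)) (h : dup t.1 i ∈ CFset (n + 2)) :
    mkS ⟨dup t.1 i, h⟩ = mkS t := mk_dup t.1 t.2 i h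

theorem joined_pp (n : ℕ) : Joined CFbase (mkS (pp n)) := by
  induction n with
  | zero => rw [pp_zero]
  | succ n ih =>
    refine ih.trans ?_
    rw [← mkS_dup (pp n) 0 (dup_pp n 0)]
    exact ⟨segF _ _⟩

theorem joined_base (x : CF) : Joined CFbase x := by
  induction x using CF_ind with
  | h t ht => exact (joined_pp _).trans ⟨segF (pp _) ⟨t, ht⟩⟩

/-- The fundamental group. -/
abbrev Gam := FundamentalGroup CF CFbase

open Classical in
/-- Chosen paths from the base point. -/
noncomputable def kap (x : CF) : Path.Homotopic.Quotient CFbase x :=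
  if h : CFbase = x then h ▸ Path.Homotopic.Quotient.refl CFbase
  else .mk (joined_base x).somePath

theorem kap_base : kap CFbase = .refl CFbase := by simp [kap]

/-- Transport of path classes to the fundamental group. -/
noncomputable def rho {x y : CF} (q : Path.Homotopic.Quotient x y) : Gam :=
  ((kap x).trans (q.trans (kap y).symm) : Path.Homotopic.Quotient CFbase CFbase)

open Path.Homotopic in
theorem rho_trans {x y z : CF} (q : Path.Homotopic.Quotient x y)
    (q' : Path.Homotopic.Quotient y z) : rho (q.trans q') = rho q' * rho q := by
  rw [FundamentalGroup.mul_def]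
  unfold rho
  have e : ∀ r : Path.Homotopic.Quotient y CFbase,
      (kap y).symm.trans ((kap y).trans r) = r := by
    intro r; rw [← Quotient.trans_assoc, Quotient.symm_trans, Quotient.refl_trans]
  simp only [Quotient.trans_assoc]
  rw [e]

open Path.Homotopic in
theorem rho_base (q : Gam) : rho (x := CFbase) (y := CFbase) q = q := by
  unfold rho
  rw [kap_base]
  have : (Path.Homotopic.Quotient.refl CFbase).symm = .refl CFbase := by
    rw [← Quotient.refl_trans (Quotient.symm _), Quotient.trans_symm]
  rw [this, Quotient.refl_trans, Quotient.trans_refl]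

open Path.Homotopic in
theorem rho_refl (x : CF) : rho (.refl x) = 1 := by
  unfold rho
  rw [Quotient.refl_trans, Quotient.trans_symm]
  rfl

/-- The class of a map of the interval. -/
noncomputable def RR (f : C(I, CF)) : Gam := rho (.mk ⟨f, rfl, rfl⟩ : Path.Homotopic.Quotient (f 0) (f 1))

theorem rho_mk {x y : CF} (γ : Path x y) : rho (.mk γ) = RR γ.toContinuousMap := by
  obtain ⟨f, rfl, rfl⟩ := γ
  rfl

/-- The class of a path. -/
noncomputable def rp {x y : CF} (γ : Path x y) : Gam := rho (.mk γ)

theorem rp_congr {x y x' y' : CF} (γ : Path x y) (γ' : Path x' y') (h : ∀ s, γ s = γ' s) :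
    rp γ = rp γ' := by
  unfold rp
  rw [rho_mk, rho_mk]
  congr 1
  ext s : 1
  exact h s

theorem rp_trans {x y z : CF} (γ : Path x y) (γ' : Path y z) :
    rp (γ.trans γ') = rp γ' * rp γ := by
  unfold rp
  rw [Path.Homotopic.Quotient.mk_trans, rho_trans]

theorem rp_homotopic {x y : CF} {γ γ' : Path x y} (h : γ.Homotopic γ') : rp γ = rp γ' := by
  unfold rp
  rw [Path.Homotopic.Quotient.eq.2 h]

theorem rp_refl (x : CF) : rp (Path.refl x) = 1 := rho_refl x

/-- The class of the segment from `u` to `t`. -/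
noncomputable def sg {n : ℕ} (t u : CFn (n + 1)) : Gam := rp (segF u t)

theorem sg_mul {n : ℕ} (t u v : CFn (n + 1)) : sg t u * sg u v = sg t v := by
  unfold sg
  rw [← rp_trans]
  exact rp_homotopic (segF_trans v u t)

theorem sg_self {n : ℕ} (t : CFn (n + 1)) : sg t t = 1 := by
  unfold sg
  rw [segF_self, rp_refl]

theorem sg_inv {n : ℕ} (t u : CFn (n + 1)) : (sg t u)⁻¹ = sg u t := by
  rw [inv_eq_iff_mul_eq_one, sg_mul, sg_self]

theorem sg_dup {n : ℕ} (t u : CFn (n + 1)) (i : Fin (n + 1)) (h : dup t.1 i ∈ CFset (n + 2))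
    (h' : dup u.1 i ∈ CFset (n + 2)) :
    sg ⟨dup t.1 i, h⟩ ⟨dup u.1 i, h'⟩ = sg t u := by
  unfold sg
  apply rp_congr
  intro s
  rw [segF_apply, segF_apply]
  have e : (segPt ⟨dup u.1 i, h'⟩ ⟨dup t.1 i, h⟩ s).1 = dup (segPt u t s).1 i := by
    funext k
    unfold segPt
    rcases Nat.lt_or_ge (i:ℕ) k with hk | hk
    · simp only [Pi.add_apply, Pi.smul_apply, dup_apply_gt _ _ _ hk]
    · simp only [Pi.add_apply, Pi.smul_apply, dup_apply_le _ _ _ hk]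
  have h2 : dup (segPt u t s).1 i ∈ CFset (n + 2) := by rw [← e]; exact Subtype.prop _
  rw [← mkS_dup _ i h2]
  congr 1
  exact Subtype.ext e

/-- The holonomy homomorphism. -/
noncomputable def Phi : Gam →* (ℝ ≃o ℝ) where
  toFun q := hol (x := CFbase) (y := CFbase) q
  map_one' := hol_refl _
  map_mul' p q := by rw [FundamentalGroup.mul_def]; exact hol_trans _ _

theorem hol_segF {n : ℕ} (t u : CFn (n + 1)) :
    hol (.mk (segF t u)) = cT u.1 * (cT t.1)⁻¹ := by
  have h : Flat (segF t u) (fun s => cT (seg t u s).1) := by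
    intro s
    have hc : Tendsto (seg t u) (𝓝 s) (𝓝 (seg t u s)) := (seg t u).continuous.continuousAt
    filter_upwards [hc.eventually (hh_cell (seg t u s))] with s' hs'
    have : hh (segF t u s) (segF t u s') = _ := hs'
    rw [this, inv_mul_cancel_right]
  rw [hol_of_flat h]
  simp

/-- Normalising factors. -/
noncomputable def KK (x : CF) : ℝ ≃o ℝ := (hol (kap x))⁻¹

theorem KK_base : KK CFbase = 1 := by rw [KK, kap_base, hol_refl, inv_one]

open Path.Homotopic in
theorem hol_symm {x y : CF} (q : Path.Homotopic.Quotient x y) : hol q.symm = (hol q)⁻¹ := by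
  rw [eq_inv_iff_mul_eq_one, ← hol_trans, Quotient.trans_symm, hol_refl]

theorem Phi_sg {n : ℕ} (t u : CFn (n + 1)) :
    Phi (sg t u) = KK (mkS t) * cT t.1 * (cT u.1)⁻¹ * (KK (mkS u))⁻¹ := by
  change hol (x := CFbase) (y := CFbase) (rho _) = _
  unfold rho
  rw [hol_trans, hol_trans, hol_segF, hol_symm]
  unfold KK
  group

end Segments

section Generation
open Filter Topology unitInterval

/-- The generating elements. -/
noncomputable def gg (n i : ℕ) : Gam :=
  if h : i ≤ n then sg ⟨dup (pp n).1 ⟨i, by omega⟩, dup_pp n _⟩ (pp (n + 1)) else 1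

theorem gg_of_le {n : ℕ} (i : Fin (n + 1)) :
    gg n i = sg ⟨dup (pp n).1 i, dup_pp n _⟩ (pp (n + 1)) := by
  have : (i : ℕ) ≤ n := by omega
  unfold gg
  rw [dif_pos this]

theorem dup_dup {n : ℕ} (t : Fin (n + 1) → ℝ) (i j : Fin (n + 1)) (hij : (i : ℕ) < j) :
    dup (dup t j) i.castSucc = dup (dup t i) j.succ := by
  funext k
  rcases Nat.lt_or_ge (i:ℕ) k with h1 | h1 <;> rcases Nat.lt_or_ge ((j : ℕ) + 1) k with h2 | h2
  · rw [dup_apply_gt _ i.castSucc k (by simpa using h1), dup_apply_gt _ j.succ k (by simpa using h2),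
      dup_apply_gt _ _ _ (by dsimp; omega), dup_apply_gt _ _ _ (by dsimp; omega)]
  · rw [dup_apply_gt _ i.castSucc k (by simpa using h1), dup_apply_le _ j.succ k (by simpa using h2),
      dup_apply_le _ _ _ (by dsimp; omega), dup_apply_gt _ _ _ (by dsimp; omega)]
  · omega
  · rw [dup_apply_le _ i.castSucc k (by simpa using h1), dup_apply_le _ j.succ k (by simpa using h2),
      dup_apply_le _ _ _ (by dsimp; omega), dup_apply_le _ _ _ (by dsimp; omega)]

theorem dup_dup_pp {n : ℕ} (i j : Fin (n + 1)) (hij : (i : ℕ) < j) :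
    dup (dup (pp n).1 j) i.castSucc ∈ CFset (n + 3) := by
  apply dup_mem (dup_pp n j)
  intro a b hab h
  have hi : ((i.castSucc : Fin (n + 2)) : ℕ) = i := rfl
  rw [hi] at h
  rw [dup_apply_le _ _ b (by omega), dup_apply_le _ _ a (by omega)]
  have : ((a : ℕ) : ℝ) + 1 = (b : ℕ) := by exact_mod_cast hab
  dsimp [pp]; linarith

theorem gg_rel : ∀ n i j, i < j → j ≤ n → gg n j * gg (n + 1) i = gg n i * gg (n + 1) (j + 1) := by
  intro n i j hij hj
  obtain ⟨i, rfl⟩ : ∃ i' : Fin (n + 1), (i' : ℕ) = i := ⟨⟨i, by omega⟩, rfl⟩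
  obtain ⟨j, rfl⟩ : ∃ i' : Fin (n + 1), (i' : ℕ) = j := ⟨⟨j, by omega⟩, rfl⟩
  have h1 := dup_dup_pp i j hij
  have h2 := h1
  rw [dup_dup _ i j hij] at h2
  have e1 : gg (n + 1) i = _ := gg_of_le i.castSucc
  have e2 : gg (n + 1) (j + 1) = _ := gg_of_le j.succ
  rw [e1, e2, gg_of_le, gg_of_le]
  rw [← sg_dup _ _ i.castSucc h1 (dup_pp _ _), ← sg_dup _ _ j.succ h2 (dup_pp _ _), sg_mul, sg_mul]
  congr 2
  exact dup_dup _ i j hij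

theorem sg_dup_pp {n : ℕ} (t : CFn (n + 1)) (i : Fin (n + 1)) (h : dup t.1 i ∈ CFset (n + 2)) :
    sg ⟨dup t.1 i, h⟩ (pp (n + 1)) = sg t (pp n) * gg n i := by
  rw [gg_of_le, ← sg_dup t (pp n) i h (dup_pp n i), sg_mul]

/-- The elements reachable at a point. -/
def TT : CF → Set Gam :=
  Quot.lift (fun q => {a | a * sg q.2 (pp q.1) ∈ Tset gg q.1}) (by
    rintro ⟨n, t⟩ _ ⟨i, h, rfl⟩
    ext a
    change a * sg t (pp n) ∈ Tset gg n ↔ a * sg ⟨dup t.1 i, h⟩ (pp (n + 1)) ∈ Tset gg (n + 1)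
    rw [sg_dup_pp t i h, ← mul_assoc]
    have hi : (i : ℕ) ≤ n := Nat.lt_succ_iff.1 i.2
    refine ⟨Tset_mul gg gg_rel hi, fun h => ?_⟩
    have := Tset_mul_inv gg hi h
    rwa [mul_inv_cancel_right] at this)

theorem mem_TT {n : ℕ} {t : CFn (n + 1)} {a : Gam} :
    a ∈ TT (mkS t) ↔ a * sg t (pp n) ∈ Tset gg n := Iff.rfl

theorem TT_sg {n : ℕ} {t : CFn (n + 1)} {a : Gam} (h : a ∈ TT (mkS t)) (u : CFn (n + 1)) :
    a * sg t u ∈ TT (mkS u) := by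
  rw [mem_TT] at *
  rwa [mul_assoc, sg_mul]

theorem TT_base {a : Gam} : a ∈ TT CFbase ↔ a ∈ Tset gg 0 := by
  have h : a ∈ TT (mkS (pp 0)) ↔ a ∈ Tset gg 0 := by rw [mem_TT, sg_self, mul_one]
  have e := congrArg TT pp_zero
  rwa [e] at h

open Classical in
/-- The contraction of `UU x`. -/
noncomputable def Hx (x : CF) : CF → C(I, CF) :=
  Quot.lift (fun q => if h : mkS q.2 ∈ UU x then
      (segF q.2 ⟨near x ∘ q.2.1, near_mem q.2.2 h⟩).toContinuousMap
      else ContinuousMap.const _ x) (by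
    rintro ⟨n, t⟩ _ ⟨i, h, rfl⟩
    have e := mkS_dup t i h
    dsimp only
    by_cases hx : mkS t ∈ UU x
    · have hx' : mkS ⟨dup t.1 i, h⟩ ∈ UU x := by rw [e]; exact hx
      rw [dif_pos hx, dif_pos hx']
      ext s : 1
      change mkS (segPt _ _ s) = mkS (segPt _ _ s)
      set u : CFn (n + 1) := ⟨near x ∘ t.1, near_mem t.2 hx⟩
      have e : (segPt ⟨dup t.1 i, h⟩ ⟨near x ∘ dup t.1 i, near_mem h hx'⟩ s).1
          = dup (segPt t u s).1 i := by
        funext k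
        unfold segPt
        dsimp only
        rw [comp_dup]
        rcases Nat.lt_or_ge (i:ℕ) k with hk | hk
        · simp only [Pi.add_apply, Pi.smul_apply, dup_apply_gt _ _ _ hk]; rfl
        · simp only [Pi.add_apply, Pi.smul_apply, dup_apply_le _ _ _ hk]; rfl
      have h2 : dup (segPt t u s).1 i ∈ CFset (n + 2) := by rw [← e]; exact Subtype.prop _
      rw [← mkS_dup _ i h2]
      congr 1
      exact Subtype.ext e.symm
    · have hx' : mkS ⟨dup t.1 i, h⟩ ∉ UU x := by rw [e]; exact hx
      rw [dif_neg hx, dif_neg hx'])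

theorem Hx_mk {n : ℕ} (t : CFn (n + 1)) {x : CF} (h : mkS t ∈ UU x) :
    Hx x (mkS t) = (segF t ⟨near x ∘ t.1, near_mem t.2 h⟩).toContinuousMap := dif_pos h

theorem near_locally {n : ℕ} (t : CFn (n + 1)) {x : CF} (h : mkS t ∈ UU x) :
    ∀ᶠ t' : CFn (n + 1) in 𝓝 t, near x ∘ t'.1 = near x ∘ t.1 := by
  have h1 : ∀ᶠ t' : CFn (n + 1) in 𝓝 t, ∀ i, |t'.1 i - near x (t.1 i)| < eps x := by
    rw [eventually_all]
    intro i
    have hc : Continuous fun t' : CFn (n + 1) => |t'.1 i - near x (t.1 i)| :=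
      (((continuous_apply i).comp continuous_subtype_val).sub continuous_const).abs
    exact hc.continuousAt.eventually_lt_const (near_spec (h.1 _ ⟨i, rfl⟩)).2
  filter_upwards [h1] with t' ht'
  funext i
  exact near_eq (near_spec (h.1 _ ⟨i, rfl⟩)).1 (ht' i)

theorem continuousOn_Hx (x : CF) : ContinuousOn (Hx x) (UU x) := by
  rw [continuousOn_open_iff (isOpen_UU x)]
  intro V hV
  apply isOpen_CF
  intro n
  rw [isOpen_iff_mem_nhds]
  rintro t0 ⟨h0, h0V⟩
  have h0' : mkS t0 ∈ UU x := h0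
  set u : CFn (n + 1) := ⟨near x ∘ t0.1, near_mem t0.2 h0'⟩
  let G : C(CFn (n + 1), C(I, CF)) :=
    ContinuousMap.curry ⟨fun p : CFn (n + 1) × I => mkS (segPt p.1 u p.2),
      continuous_mkS.comp (continuous_segPt.comp
        (by fun_prop : Continuous fun p : CFn (n + 1) × I => (p.1, u, p.2)))⟩
  have hG : ∀ t : CFn (n + 1), mkS t ∈ UU x → near x ∘ t.1 = near x ∘ t0.1 →
      Hx x (mkS t) = G t := by
    intro t ht hn
    rw [Hx_mk t ht]
    ext s : 1
    change mkS (segPt _ _ s) = mkS (segPt _ _ s)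
    congr 2
    exact Subtype.ext hn
  have hU : ∀ᶠ t : CFn (n + 1) in 𝓝 t0, mkS t ∈ UU x :=
    continuous_mkS.continuousAt.eventually ((isOpen_UU x).mem_nhds h0')
  have hGV : ∀ᶠ t in 𝓝 t0, G t ∈ V := by
    apply G.continuous.continuousAt.eventually (hV.mem_nhds _)
    rw [← hG t0 h0' rfl]; exact h0V
  filter_upwards [hU, near_locally t0 h0', hGV] with t h1 h2 h3
  refine ⟨h1, ?_⟩
  change Hx x (mkS t) ∈ V
  rw [hG t h1 h2]; exact h3

/-- The identity path of the interval. -/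
def idp : Path (0 : I) 1 := ⟨ContinuousMap.id _, rfl, rfl⟩

theorem contr_I : ContractibleSpace I := (convex_Icc (0:ℝ) 1).contractibleSpace ⟨0, by simp⟩

theorem square (K : C(I × I, CF)) :
    rp (((Path.refl (1 : I)).prod idp).map K.continuous) *
      rp ((idp.prod (Path.refl (0 : I))).map K.continuous) =
    rp ((idp.prod (Path.refl (1 : I))).map K.continuous) *
      rp (((Path.refl (0 : I)).prod idp).map K.continuous) := by
  rw [← rp_trans, ← rp_trans]
  have := contr_I
  have : SimplyConnectedSpace (I × I) := inferInstance
  have h : ((idp.prod (Path.refl (0 : I))).trans ((Path.refl (1 : I)).prod idp)).Homotopic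
     (((Path.refl (0 : I)).prod idp).trans (idp.prod (Path.refl (1 : I)))) :=
    SimplyConnectedSpace.paths_homotopic _ _
  have := h.map K
  rw [Path.map_trans, Path.map_trans] at this
  exact rp_homotopic this

theorem TT_step {x y y' : CF} (γ : Path y y') (hγ : ∀ s, γ s ∈ UU x) {a : Gam} (ha : a ∈ TT y) :
    a * (rp γ)⁻¹ ∈ TT y' := by
  obtain ⟨n, t, rfl⟩ : ∃ (n : ℕ) (t : CFn (n + 1)), y = mkS t := by
    induction y using CF_ind with
    | h t ht => exact ⟨_, ⟨t, ht⟩, rfl⟩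
  obtain ⟨m, t', rfl⟩ : ∃ (n : ℕ) (t : CFn (n + 1)), y' = mkS t := by
    induction y' using CF_ind with
    | h t ht => exact ⟨_, ⟨t, ht⟩, rfl⟩
  have ht : mkS t ∈ UU x := by simpa using hγ 0
  have ht' : mkS t' ∈ UU x := by simpa using hγ 1
  set u : CFn (n + 1) := ⟨near x ∘ t.1, near_mem t.2 ht⟩
  set u' : CFn (m + 1) := ⟨near x ∘ t'.1, near_mem t'.2 ht'⟩
  have hu : mkS u = x := near_mk t.2 ht
  have hu' : mkS u' = x := near_mk t'.2 ht'
  have hc : Continuous fun s => Hx x (γ s) :=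
    (continuousOn_Hx x).comp_continuous γ.continuous hγ
  let K : C(I × I, CF) := ContinuousMap.uncurry ⟨fun s => Hx x (γ s), hc⟩
  have hK : ∀ s s', K (s, s') = Hx x (γ s) s' := fun _ _ => rfl
  have ends : ∀ y ∈ UU x, Hx x y 0 = y ∧ Hx x y 1 = x := by
    intro y hy
    induction y using CF_ind with
    | h t ht =>
      have e := Hx_mk ⟨t, ht⟩ hy
      have e' : Hx x (mk t ht) = _ := e
      rw [e']
      refine ⟨Path.source _, ?_⟩
      exact (Path.target _).trans (near_mk ht hy)
  have h := square K
  have e1 : rp (((Path.refl (1 : I)).prod idp).map K.continuous) = sg u' t' := by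
    apply rp_congr
    intro s
    change Hx x (γ 1) s = _
    rw [γ.target, Hx_mk t' ht']; rfl
  have e2 : rp (((Path.refl (0 : I)).prod idp).map K.continuous) = sg u t := by
    apply rp_congr
    intro s
    change Hx x (γ 0) s = _
    rw [γ.source, Hx_mk t ht]; rfl
  have e3 : rp ((idp.prod (Path.refl (0 : I))).map K.continuous) = rp γ := by
    apply rp_congr
    intro s
    exact (ends _ (hγ s)).1
  have e4 : rp ((idp.prod (Path.refl (1 : I))).map K.continuous) = 1 := by
    rw [← rp_refl x]
    apply rp_congr
    intro s
    exact (ends _ (hγ s)).2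
  rw [e1, e2, e3, e4, one_mul] at h
  have e5 : (rp γ)⁻¹ = sg t u * sg u' t' := by
    rw [← sg_inv u t, ← h]; group
  rw [e5, ← mul_assoc]
  apply TT_sg
  have := TT_sg ha u
  rw [hu']
  rwa [hu] at this

theorem TT_path (γ : Path CFbase CFbase) : (rp γ)⁻¹ ∈ TT CFbase := by
  let f : I → Prop := fun τ => (rp (γ.subpath 0 τ))⁻¹ ∈ TT (γ τ)
  have step : ∀ τ τ' : I, ∀ x, (∀ s ∈ Set.uIcc τ τ', γ s ∈ UU x) → f τ → f τ' := by
    intro τ τ' x hx h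
    have e := rp_homotopic ⟨Path.Homotopy.subpathTransSubpath γ 0 τ τ'⟩
    rw [rp_trans] at e
    change (rp (γ.subpath 0 τ'))⁻¹ ∈ TT (γ τ')
    rw [← e, mul_inv_rev]
    refine TT_step (x := x) (γ.subpath τ τ') (fun s => ?_) h
    have : γ.subpath τ τ' s ∈ Set.range (γ.subpath τ τ') := ⟨s, rfl⟩
    rw [Path.range_subpath] at this
    obtain ⟨r, hr, hr'⟩ := this
    rw [← hr']
    exact hx r hr
  have hf : IsLocallyConstant f := by
    rw [IsLocallyConstant.iff_eventually_eq]
    intro τ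
    have hn : γ ⁻¹' UU (γ τ) ∈ 𝓝 τ :=
      γ.continuous.continuousAt.preimage_mem_nhds ((isOpen_UU _).mem_nhds (mem_UU_self _))
    obtain ⟨b, c, h1, h2, h3⟩ := exists_Icc_mem_subset_of_mem_nhds hn
    filter_upwards [h2] with τ' hτ'
    refine propext ⟨step τ' τ (γ τ) fun s hs => h3 ?_, step τ τ' (γ τ) fun s hs => h3 ?_⟩
    · exact Set.uIcc_subset_Icc hτ' h1 hs
    · exact Set.uIcc_subset_Icc h1 hτ' hs
  have h0 : f 0 := by
    change (rp (γ.subpath 0 0))⁻¹ ∈ TT (γ 0)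
    rw [Path.subpath_self, rp_refl, inv_one, γ.source, TT_base]
    exact one_mem_Tset gg
  have h1 : f 1 := by rwa [← hf.apply_eq_of_preconnectedSpace 0 1]
  have e : rp (γ.subpath 0 1) = rp γ := by
    apply rp_congr
    intro s
    rw [Path.subpath_zero_one]; rfl
  change (rp (γ.subpath 0 1))⁻¹ ∈ TT (γ 1) at h1
  rwa [e, γ.target] at h1

theorem mem_Tset (a : Gam) : a ∈ Tset gg 0 := by
  rw [← TT_base, ← inv_inv a]
  have : ∃ γ : Path CFbase CFbase, rp γ = a⁻¹ := by
    obtain ⟨γ, hγ⟩ := Path.Homotopic.Quotient.mk_surjective (a⁻¹ : Gam)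
    exact ⟨γ, by unfold rp; rw [hγ]; exact rho_base _⟩
  obtain ⟨γ, hγ⟩ := this
  rw [← hγ]
  exact TT_path γ

theorem cT_pp (n : ℕ) : cT (pp n).1 = 1 := by
  have : ∀ k ≤ n, cc (ht (pp n).1) k = 1 := by
    intro k
    induction k with
    | zero => intro _; rfl
    | succ k ih =>
      intro hk
      rw [cc.eq_2, ih (by omega), one_mul, if_neg]
      rw [ht_of_le _ (by omega), ht_of_le _ hk]
      dsimp [pp]
      push_cast
      intro h
      linarith
  exact this n le_rfl

theorem Phi_gg {n i : ℕ} (hi : i ≤ n) :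
    Phi (gg n i) = KK (mkS (pp n)) * lam i * (KK (mkS (pp (n + 1))))⁻¹ := by
  obtain ⟨i, rfl⟩ : ∃ i' : Fin (n + 1), (i' : ℕ) = i := ⟨⟨i, by omega⟩, rfl⟩
  rw [gg_of_le, Phi_sg, mkS_dup, cT_pp]
  dsimp only
  rw [cT_dup _ _ (dup_pp n i), cT_pp]
  group

theorem Phi_Ew (w : List ℕ) : ∀ n, Valid n w → Phi (Ew gg n w) =
    KK (mkS (pp n)) * Lw w * (KK (mkS (pp (n + w.length))))⁻¹ := by
  induction w with
  | nil =>
    intro n _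
    change Phi 1 = KK (mkS (pp n)) * 1 * (KK (mkS (pp n)))⁻¹
    rw [map_one]; group
  | cons i w ih =>
    rintro n ⟨hi, hw⟩
    change Phi (gg n i * Ew gg (n + 1) w) = KK (mkS (pp n)) * (lam i * Lw w) * _
    rw [map_mul, Phi_gg hi, ih _ hw, List.length_cons,
      show n + (w.length + 1) = n + 1 + w.length by omega]
    group

theorem Phi_frac {w v : List ℕ} (hw : Valid 0 w) (hv : Valid 0 v) (hl : w.length = v.length) :
    Phi (Ew gg 0 w * (Ew gg 0 v)⁻¹) = Lw w * (Lw v)⁻¹ := by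
  rw [map_mul, map_inv, Phi_Ew w 0 hw, Phi_Ew v 0 hv, pp_zero, KK_base, hl]
  group

theorem Phi_injective : Function.Injective Phi := by
  rw [injective_iff_map_eq_one]
  intro a ha
  obtain ⟨w, v, hw, hv, hl, rfl⟩ := mem_Tset a
  rw [zero_add] at hl
  rw [Phi_frac hw hv hl, mul_inv_eq_one] at ha
  rw [mul_inv_eq_one]
  exact Ew_inj gg gg_rel w 0 v hw hv hl ha

theorem Phi_range (f : unitI ≃ₜ unitI) :
    IsThompsonF f ↔ ∃ a : Gam, permHom (Phi a) = extHom f := by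
  constructor
  · intro hf
    obtain ⟨w, v, hw, hv, hl, e⟩ := thompson_frac f hf
    exact ⟨_, by rw [Phi_frac hw hv hl, e]⟩
  · rintro ⟨a, ha⟩
    obtain ⟨w, v, hw, hv, hl, rfl⟩ := mem_Tset a
    rw [zero_add] at hl
    rw [Phi_frac hw hv hl] at ha
    obtain ⟨f', hf', e⟩ := frac_thompson w v hw hv hl
    rwa [← extHom_injective (e.trans ha)]

theorem Phi_lift (a : Gam) : ∃ f, extHom f = permHom (Phi a) := by
  obtain ⟨w, v, hw, hv, hl, rfl⟩ := mem_Tset a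
  rw [zero_add] at hl
  rw [Phi_frac hw hv hl]
  obtain ⟨f', hf', e⟩ := frac_thompson w v hw hv hl
  exact ⟨f', e⟩

theorem final_iso :
    ∃ S : Subgroup (unitI ≃ₜ unitI), (S : Set (unitI ≃ₜ unitI)) = {f | IsThompsonF f} ∧
      Nonempty (FundamentalGroup CF CFbase ≃* S) := by
  choose L hL using Phi_lift
  let M : Gam →* (unitI ≃ₜ unitI) :=
    { toFun := L
      map_one' := extHom_injective (by rw [hL, map_one, map_one, map_one])
      map_mul' := fun a b => extHom_injective (by rw [map_mul, hL, hL, hL, map_mul, map_mul]) }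
  have hM : Function.Injective M := by
    intro a b h
    apply Phi_injective
    apply permHom_injective
    rw [← hL, ← hL]
    exact congrArg extHom h
  refine ⟨M.range, ?_, ⟨MonoidHom.ofInjective hM⟩⟩
  ext f
  rw [SetLike.mem_coe, MonoidHom.mem_range, Set.mem_ofPred_eq, Phi_range]
  refine exists_congr fun a => ?_
  rw [← hL]
  exact ⟨fun h => congrArg extHom h, fun h => extHom_injective h⟩

end Generation
/-- The fundamental group of Belk's space `CF` is isomorphic to Thompson's group `F`,
the subgroup of the homeomorphism group of `[0,1]` consisting of the piecewise-linear
homeomorphisms with dyadic breakpoints and slopes powers of `2`. -/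
theorem CF_fundamental_group_is_ThompsonF :
    ∃ S : Subgroup (unitI ≃ₜ unitI), (S : Set (unitI ≃ₜ unitI)) = {f | IsThompsonF f} ∧
      Nonempty (FundamentalGroup CF CFbase ≃* S) := by
  exact final_iso
end

section
/- For every n ≥ 1, the ordered configuration space Conf_n(ℂ) of n distinct points in the plane is path-connected and aspherical: π_k(Conf_n(ℂ)) is trivial for every k ≥ 2. (This is the homotopy-theoretic content of the classical fact that Conf_n(ℂ) is a classifying space for the pure braid group PB_n.) -/
/-- The ordered configuration space of `n` points in the plane `ℂ`:
injective tuples, topologized as a subspace of `ℂ^n`. -/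
abbrev Conf (n : ℕ) := {f : Fin n → ℂ // Function.Injective f}

namespace ConfAux

open Metric ComplexConjugate

/-- Blaschke/Moebius map of the disc. -/
noncomputable def mo (b u : ℂ) : ℂ := (u + b) / (1 + conj b * u)

lemma mo_den {b u : ℂ} (hb : ‖b‖ < 1) (hu : ‖u‖ < 1) : 1 + conj b * u ≠ 0 := by
  intro h
  have h1 : conj b * u = -1 := by linear_combination h
  have h2 : ‖b‖ * ‖u‖ = 1 := by
    have := congrArg norm h1
    simpa using this
  nlinarith [norm_nonneg b, norm_nonneg u]

lemma mo_sq {b u : ℂ} (hb : ‖b‖ < 1) (hu : ‖u‖ < 1) :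
    ‖mo b u‖ ^ 2 ≤ 1 - (1 - ‖u‖ ^ 2) * (1 - ‖b‖ ^ 2) / 4 := by
  have hd := mo_den hb hu
  have hpos : 0 < ‖1 + conj b * u‖ := norm_pos_iff.2 hd
  have hle : ‖1 + conj b * u‖ ≤ 2 := by
    calc ‖1 + conj b * u‖ ≤ ‖(1:ℂ)‖ + ‖conj b * u‖ := norm_add_le _ _
      _ ≤ 2 := by
        simp only [norm_one, norm_mul, RCLike.norm_conj]
        nlinarith [norm_nonneg b, norm_nonneg u]
  have key : ‖u + b‖ ^ 2 = ‖1 + conj b * u‖ ^ 2 - (1 - ‖u‖ ^ 2) * (1 - ‖b‖ ^ 2) := by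
    simp only [← Complex.normSq_eq_norm_sq, Complex.normSq_apply]
    simp
    ring
  have hP : 0 ≤ (1 - ‖u‖ ^ 2) * (1 - ‖b‖ ^ 2) := by
    apply mul_nonneg <;> nlinarith [norm_nonneg b, norm_nonneg u]
  rw [mo, norm_div, div_pow, key, div_le_iff₀ (by positivity)]
  have h4 : ‖1 + conj b * u‖ ^ 2 ≤ 4 := by nlinarith
  nlinarith [mul_le_mul_of_nonneg_left h4 hP]

lemma mo_lt {b u : ℂ} (hb : ‖b‖ < 1) (hu : ‖u‖ < 1) : ‖mo b u‖ < 1 := by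
  have := mo_sq hb hu
  have : 0 < (1 - ‖u‖ ^ 2) * (1 - ‖b‖ ^ 2) := by
    apply mul_pos <;> nlinarith [norm_nonneg b, norm_nonneg u]
  nlinarith [norm_nonneg (mo b u)]

lemma mo_inv {b u : ℂ} (hb : ‖b‖ < 1) (hu : ‖u‖ < 1) : mo (-b) (mo b u) = u := by
  have hd := mo_den hb hu
  have hd2 := mo_den (b := -b) (u := mo b u) (by simpa using hb) (mo_lt hb hu)
  have hv : mo b u * (1 + conj b * u) = u + b := div_mul_cancel₀ _ hd
  rw [mo, div_eq_iff hd2]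
  simp only [map_neg]
  linear_combination hv

lemma mo_inv' {b u : ℂ} (hb : ‖b‖ < 1) (hu : ‖u‖ < 1) : mo b (mo (-b) u) = u := by
  simpa using mo_inv (b := -b) (by simpa using hb) hu

lemma mo_self (b : ℂ) : mo (-b) b = 0 := by simp [mo]

lemma mo_zero (b : ℂ) : mo b 0 = b := by simp [mo]

lemma mo_diff {b : ℂ} (hb : ‖b‖ < 1) : DifferentiableOn ℂ (mo b) (ball 0 1) := by
  intro u hu
  have := mo_den hb (by simpa using hu)
  unfold mo
  apply DifferentiableAt.differentiableWithinAt
  fun_prop (disch := assumption)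

lemma mo_cont {X : Type*} [TopologicalSpace X] {b : ℂ} (hb : ‖b‖ < 1) {f : X → ℂ}
    (hf : Continuous f) (h : ∀ x, ‖f x‖ < 1) : Continuous fun x => mo b (f x) := by
  unfold mo
  exact (by fun_prop : Continuous fun x => f x + b).div (by fun_prop)
    fun x => mo_den hb (h x)

/-- Schwarz-Pick type estimate. -/
lemma pick {s : ℂ → ℂ} (hs : DifferentiableOn ℂ s (ball 0 1)) (hm : ∀ w ∈ ball (0:ℂ) 1, ‖s w‖ < 1)
    {w : ℂ} (hw : ‖w‖ ≤ 1 / 2) : (1 - ‖s 0‖ ^ 2) * (3 / 16) ≤ 1 - ‖s w‖ ^ 2 := by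
  have h0 : ‖s 0‖ < 1 := hm 0 (by simp)
  have hn : ‖-s 0‖ < 1 := by simpa using h0
  have hw1 : ‖w‖ < 1 := by linarith
  have h1 : ‖mo (-s 0) (s w)‖ ≤ ‖w‖ := by
    apply Complex.norm_le_norm_of_mapsTo_ball (R := 1) (f := fun z => mo (-s 0) (s z)) _ _ _ hw1
    · exact (mo_diff hn).comp hs (fun z hz => by simpa using hm z hz)
    · intro z hz
      simpa using (mo_lt hn (hm z hz)).le
    · exact mo_self _
  have h2 := mo_sq (b := s 0) (u := mo (-s 0) (s w)) h0 (by linarith)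
  rw [mo_inv' h0 (hm w (by simpa using hw1))] at h2
  have h3 : ‖mo (-s 0) (s w)‖ ^ 2 ≤ 1 / 4 := by nlinarith [norm_nonneg (mo (-s 0) (s w))]
  have h4 : 0 ≤ 1 - ‖s 0‖ ^ 2 := by nlinarith [norm_nonneg (s 0)]
  nlinarith

/-- Holomorphic square root on the disc. -/
lemma holo_sqrt {h : ℂ → ℂ} (hd : DifferentiableOn ℂ h (ball 0 1))
    (h0 : ∀ w ∈ ball (0:ℂ) 1, h w ≠ 0) :
    ∃ t : ℂ → ℂ, DifferentiableOn ℂ t (ball 0 1) ∧ ∀ w ∈ ball (0:ℂ) 1, t w ^ 2 = h w := by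
  have hd' : DifferentiableOn ℂ (fun z => deriv h z / h z) (ball 0 1) :=
    (hd.deriv isOpen_ball).div hd h0
  obtain ⟨L, hL⟩ := hd'.isExactOn_ball
  have hLd : DifferentiableOn ℂ L (ball 0 1) :=
    fun z hz => (hL z hz).differentiableAt.differentiableWithinAt
  have hconst : ∀ w ∈ ball (0:ℂ) 1, h w * Complex.exp (-L w) = h 0 * Complex.exp (-L 0) := by
    intro w hw
    refine (convex_ball (0:ℂ) 1).is_const_of_fderivWithin_eq_zero (𝕜 := ℂ)
      (f := fun z => h z * Complex.exp (-L z)) (hd.mul hLd.neg.cexp) ?_ hw (by simp)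
    intro z hz
    have hz' := isOpen_ball.mem_nhds hz
    have h1 : HasDerivAt h (deriv h z) z := (hd.differentiableAt hz').hasDerivAt
    have h2 := h1.mul (hL z hz).neg.cexp
    rw [fderivWithin_of_isOpen isOpen_ball hz]
    have h3 : HasDerivAt (fun z => h z * Complex.exp (-L z)) 0 z := by
      convert! h2 using 1
      have := h0 z hz
      field_simp
      ring
    ext
    simpa using h3.deriv
  obtain ⟨c, hc⟩ := IsAlgClosed.exists_pow_nat_eq (h 0 * Complex.exp (-L 0)) (n := 2) (by norm_num)
  refine ⟨fun w => c * Complex.exp (L w / 2), ?_, ?_⟩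
  · exact (hLd.div_const 2).cexp.const_mul c
  · intro w hw
    rw [mul_pow, hc, ← hconst w hw, ← Complex.exp_nat_mul, mul_assoc, ← Complex.exp_add]
    have : -L w + ((2:ℕ):ℂ) * (L w / 2) = 0 := by push_cast; ring
    rw [this]; simp

open scoped unitInterval Topology

lemma cube_sqrt {k : ℕ} {h : (Fin k → I) → ℂ} (hc : Continuous h) (h0 : ∀ y, h y ≠ 0) :
    ∃ s : (Fin k → I) → ℂ, Continuous s ∧ ∀ y, s y ^ 2 = h y := by
  let H : C(I × (Fin k → I), {z : ℂ // z ≠ 0}) :=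
    ⟨fun p => ⟨h (fun i => p.1 * p.2 i), h0 _⟩, by fun_prop⟩
  have cov := Complex.isCoveringMap_exp
  have e0 : ∀ a, H (0, a) = (⟨_, (Complex.log (h 0)).exp_ne_zero⟩ : {z : ℂ // z ≠ 0}) := by
    intro a
    apply Subtype.ext
    simp only [H, ContinuousMap.coe_mk, zero_mul]
    rw [Complex.exp_log (h0 _)]
    rfl
  let G := cov.liftHomotopy H (.const _ (Complex.log (h 0))) e0
  have hG := cov.liftHomotopy_lifts H (.const _ (Complex.log (h 0))) e0
  refine ⟨fun y => Complex.exp (G (1, y) / 2), by fun_prop, fun y => ?_⟩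
  have := congrArg Subtype.val (congrFun hG (1, y))
  simp only [Function.comp_apply, H, ContinuousMap.coe_mk, one_mul] at this
  rw [← Complex.exp_nat_mul, ← this]
  congr 1
  push_cast
  ring_nf
  rfl

lemma boundary_preconnected {k : ℕ} (hk : 2 ≤ k) : IsPreconnected (Cube.boundary (Fin k)) := by
  have hr : 1 < Module.rank ℝ (Fin k → ℝ) := by
    simp only [rank_fun', Fintype.card_fin]
    exact_mod_cast hk
  have hs := isPreconnected_sphere hr (fun _ => (1/2:ℝ)) (1/2)
  let φ : (Fin k → ℝ) → (Fin k → I) := fun v i => Set.projIcc 0 1 zero_le_one (v i)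
  have hφ : Continuous φ := by
    refine continuous_pi fun i => continuous_projIcc.comp (continuous_apply i)
  have : Cube.boundary (Fin k) = φ '' (sphere (fun _ => (1/2:ℝ)) (1/2)) := by
    have : Nonempty (Fin k) := ⟨⟨0, by omega⟩⟩
    ext y
    constructor
    · rintro ⟨i, hi⟩
      refine ⟨fun j => y j, ?_, ?_⟩
      · rw [mem_sphere]
        apply le_antisymm
        · rw [dist_pi_le_iff (by norm_num)]
          intro j
          rw [Real.dist_eq, abs_le]
          have := (y j).2.1
          have := (y j).2.2
          constructor <;> linarith
        · refine le_trans ?_ (dist_le_pi_dist _ _ i)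
          rw [Real.dist_eq]
          rcases hi with hi | hi <;> rw [hi] <;> norm_num
      · ext j
        simp [φ]
    · rintro ⟨v, hv, rfl⟩
      rw [mem_sphere] at hv
      by_contra hcon
      have hcon' : ∀ i, v i ∈ Set.Ioo (0:ℝ) 1 := by
        intro i
        simp only [Cube.boundary, Set.mem_ofPred_eq, not_exists, not_or] at hcon
        have := hcon i
        simp only [φ] at this
        constructor
        · by_contra h
          exact this.1 (Set.projIcc_of_le_left _ (not_lt.1 h))
        · by_contra h
          exact this.2 (Set.projIcc_of_right_le _ (not_lt.1 h))
      have : dist v (fun _ => (1/2:ℝ)) < 1/2 := by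
        rw [dist_pi_lt_iff (by norm_num)]
        intro j
        rw [Real.dist_eq, abs_lt]
        have := hcon' j
        constructor <;> linarith [this.1, this.2]
      linarith
  rw [this]
  exact hs.image _ hφ.continuousOn

lemma closedBall_preconnected {k : ℕ} (x : Fin k → I) {e : ℝ} (he : 0 ≤ e) :
    IsPreconnected (closedBall x e) := by
  rw [closedBall_pi _ he]
  apply isPreconnected_univ_pi
  intro i
  apply Set.OrdConnected.isPreconnected
  constructor
  intro a ha b hb c hc
  rw [mem_closedBall, Subtype.dist_eq, Real.dist_eq, abs_le] at *
  have h1 : (a:ℝ) ≤ c := hc.1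
  have h2 : (c:ℝ) ≤ b := hc.2
  constructor <;> linarith [ha.1, hb.2]

/-- local data: `F` is locally a holomorphic image of the fixed maps `g x`. -/
def Good {k : ℕ} (g : (Fin k → I) → (Fin k → I) → ℂ) (e : ℝ) (O : Set ℂ)
    (F : (Fin k → I) → ℂ) : Prop :=
  Continuous F ∧ (∀ y ∈ Cube.boundary (Fin k), F y = 0) ∧
  ∀ x, ∃ s : ℂ → ℂ, DifferentiableOn ℂ s (ball 0 1) ∧ (∀ w ∈ ball (0:ℂ) 1, s w ∈ O) ∧
    ∀ y ∈ closedBall x e, F y = s (g x y)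

/-- `F` is null-homotopic rel boundary inside `O`. -/
def Null {k : ℕ} (O : Set ℂ) (F : (Fin k → I) → ℂ) (c : ℂ) : Prop :=
  ∃ H : I × (Fin k → I) → ℂ, Continuous H ∧ (∀ y, H (0, y) = F y) ∧ (∀ y, H (1, y) = c) ∧
    (∀ t, ∀ y ∈ Cube.boundary (Fin k), H (t, y) = c) ∧ ∀ p, H p ∈ O

structure GOK {k : ℕ} (g : (Fin k → I) → (Fin k → I) → ℂ) (e : ℝ) : Prop where
  pos : 0 < e
  zero : ∀ x, g x x = 0
  cont : ∀ x, Continuous (g x)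
  small : ∀ x, ∀ y ∈ closedBall x e, ‖g x y‖ ≤ 1 / 2

lemma Good.mem {k : ℕ} {g : (Fin k → I) → (Fin k → I) → ℂ} {e : ℝ} {O : Set ℂ}
    {F : (Fin k → I) → ℂ} (hF : Good g e O F) (hg : GOK g e) (y) : F y ∈ O := by
  obtain ⟨s, -, h1, h2⟩ := hF.2.2 y
  rw [h2 y (by simpa using hg.pos.le), hg.zero]
  exact h1 0 (by simp)

lemma Good.bound {k : ℕ} (hk : 2 ≤ k) {g : (Fin k → I) → (Fin k → I) → ℂ} {e : ℝ}
    (hg : GOK g e) {N : ℕ} (hN0 : 0 < N) (hN : 1 / (N:ℝ) ≤ e) {O : Set ℂ} (hO : O ⊆ ball 0 1)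
    {F : (Fin k → I) → ℂ} (hF : Good g e O F) (y) : (3/16:ℝ) ^ N ≤ 1 - ‖F y‖ ^ 2 := by
  have hN' : (0:ℝ) < N := by exact_mod_cast hN0
  let pt : ℕ → (Fin k → I) := fun j i => ⟨min 1 ((j:ℝ) / N), by positivity, min_le_left _ _⟩ * y i
  have step : ∀ x, ∀ y ∈ closedBall x e, (1 - ‖F x‖ ^ 2) * (3/16) ≤ 1 - ‖F y‖ ^ 2 := by
    intro x y hy
    obtain ⟨s, h0, h1, h2⟩ := hF.2.2 x
    rw [h2 x (by simpa using hg.pos.le), hg.zero, h2 y hy]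
    exact pick h0 (fun w hw => by simpa using hO (h1 w hw)) (hg.small x y hy)
  have main : ∀ j, (3/16:ℝ) ^ j ≤ 1 - ‖F (pt j)‖ ^ 2 := by
    intro j
    induction j with
    | zero =>
      have : F (pt 0) = 0 := hF.2.1 _ ⟨⟨0, by omega⟩, Or.inl (by
        apply Subtype.ext
        simp [pt])⟩
      simp [this]
    | succ j ih =>
      refine le_trans ?_ (step (pt j) (pt (j+1)) ?_)
      · rw [pow_succ]; nlinarith
      · rw [mem_closedBall, dist_pi_le_iff hg.pos.le]
        intro i
        refine le_trans ?_ hN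
        rw [Subtype.dist_eq, Real.dist_eq]
        simp only [pt, Set.Icc.coe_mul]
        rw [← sub_mul, abs_mul]
        have a1 : |min 1 (((j+1:ℕ):ℝ)/N) - min 1 ((j:ℝ)/N)| ≤ 1 / N := by
          refine (abs_min_sub_min_le_max _ _ _ _).trans ?_
          have : ((j+1:ℕ):ℝ)/N - (j:ℝ)/N = 1 / N := by push_cast; ring
          rw [this]
          simp
        have a2 : |(y i : ℝ)| ≤ 1 := by rw [abs_of_nonneg (y i).2.1]; exact (y i).2.2
        calc _ ≤ (1 / (N:ℝ)) * 1 := mul_le_mul a1 a2 (abs_nonneg _) (by positivity)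
          _ = _ := mul_one _
  have hy : pt N = y := by
    ext i
    simp [pt, hN'.ne']
  simpa [hy] using main N

lemma mo_eq_zero {a z : ℂ} (ha : ‖a‖ < 1) (hz : ‖z‖ < 1) (h : mo (-a) z = 0) : z = a := by
  have := mo_inv' (b := a) ha hz
  rw [h, mo_zero] at this
  exact this.symm

lemma blaschke {a b w : ℂ} (hb : ‖b‖ < 1) (hab : b ^ 2 = -a) (hw : ‖w‖ < 1) :
    mo a (mo b w ^ 2) = w * mo b (mo b w) := by
  have hu := mo_lt hb hw
  have hw' := mo_inv hb hw
  set u := mo b w with hu'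
  have d1 := mo_den (b := -b) (u := u) (by simpa using hb) hu
  have d2 := mo_den hb hu
  have ha : a = -b ^ 2 := by rw [hab]; simp
  have d3 : 1 + conj a * u ^ 2 = (1 + conj (-b) * u) * (1 + conj b * u) := by
    rw [ha]; simp only [map_neg, map_pow]; ring
  rw [← hw', mo, d3, mo, mo, div_mul_div_comm, ha]
  congr 1
  ring

lemma step {k : ℕ} (hk : 2 ≤ k) {g : (Fin k → I) → (Fin k → I) → ℂ} {e : ℝ}
    (hg : GOK g e) {O : Set ℂ} (hO : O ⊆ ball 0 1) {F : (Fin k → I) → ℂ} (hF : Good g e O F)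
    {ρ r : ℝ} (hρ : ρ < 1) {a : ℂ} (haO : a ∉ O) (ha : ‖a‖ < ρ)
    (hr : ball 0 r ⊆ O) :
    ∃ O' F', O' ⊆ ball 0 1 ∧ Good g e O' F' ∧
      (∀ r' ≤ ρ, √(1 - (1 - ρ ^ 2) * (1 - ρ) ^ 2 / 16) * r' ≤ r → ball 0 r' ⊆ O') ∧
      (Null O' F' 0 → Null O F 0) := by
  have hρ0 : 0 < ρ := (norm_nonneg a).trans_lt ha
  have ha1 : ‖a‖ < 1 := ha.trans hρ
  have hna1 : ‖-a‖ < 1 := by simpa using ha1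
  have hO' : ∀ z ∈ O, ‖z‖ < 1 := fun z hz => by simpa using hO hz
  have hFO := hF.mem hg
  obtain ⟨hFc, hFb, hFs⟩ := hF
  have nz : ∀ z ∈ O, mo (-a) z ≠ 0 := fun z hz h => haO (mo_eq_zero ha1 (hO' z hz) h ▸ hz)
  obtain ⟨s, hsc, hs⟩ := cube_sqrt (mo_cont hna1 hFc fun y => hO' _ (hFO y)) fun y => nz _ (hFO y)
  have hs1 : ∀ y, ‖s y‖ < 1 := by
    intro y
    have : ‖s y‖ ^ 2 < 1 := by rw [← norm_pow, hs]; exact mo_lt hna1 (hO' _ (hFO y))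
    nlinarith [norm_nonneg (s y)]
  have hs0 : ∀ y, s y ≠ 0 := by
    intro y h
    have := hs y
    rw [h] at this
    exact nz _ (hFO y) (by rw [← this]; simp)
  have z0 : (0 : Fin k → I) ∈ Cube.boundary (Fin k) := ⟨⟨0, by omega⟩, Or.inl rfl⟩
  set b := s 0 with hbdef
  have hb1 : ‖b‖ < 1 := hs1 0
  have hnb1 : ‖-b‖ < 1 := by simpa using hb1
  have hbn0 : b ≠ 0 := hs0 0
  have hb2 : b ^ 2 = -a := by rw [hbdef, hs, hFb 0 z0, mo_zero]
  have hsb : ∀ y ∈ Cube.boundary (Fin k), s y = b := by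
    have := (boundary_preconnected hk).eq_of_sq_eq (f := s) (g := fun _ => b)
      hsc.continuousOn continuousOn_const (fun y hy => by
        simp only [Pi.pow_apply]
        rw [hs, hFb y hy, mo_zero, hb2]) (fun _ => hbn0) z0 rfl
    exact fun y hy => this hy
  have hbρ : ‖b‖ ^ 2 ≤ ρ := by rw [← norm_pow, hb2, norm_neg]; exact ha.le
  have hpinv : ∀ t z : ℂ, ‖t‖ < 1 → ‖z‖ < 1 → t ^ 2 = mo (-a) z →
      mo a (mo b (mo (-b) t) ^ 2) = z := by
    intro t z ht hz h
    rw [mo_inv' hb1 ht, h, mo_inv' ha1 hz]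
  have hsq1 : ∀ w : ℂ, ‖w‖ < 1 → ‖mo b w ^ 2‖ < 1 := by
    intro w hw
    rw [norm_pow]
    have := mo_lt hb1 hw
    nlinarith [norm_nonneg (mo b w)]
  refine ⟨{w | ‖w‖ < 1 ∧ mo a (mo b w ^ 2) ∈ O}, fun y => mo (-b) (s y), ?_, ⟨?_, ?_, ?_⟩, ?_, ?_⟩
  · intro w hw; simpa using hw.1
  · exact mo_cont hnb1 hsc hs1
  · intro y hy
    simp only [hsb y hy, mo_self]
  · intro x
    obtain ⟨sg, h1, h2, h3⟩ := hFs x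
    obtain ⟨τ, ht1, ht2⟩ := holo_sqrt (h := fun w => mo (-a) (sg w))
      ((mo_diff hna1).comp h1 fun w hw => hO (h2 w hw)) fun w hw => nz _ (h2 w hw)
    have ht3 : ∀ w ∈ ball (0:ℂ) 1, ‖τ w‖ < 1 := by
      intro w hw
      have : ‖τ w‖ ^ 2 < 1 := by rw [← norm_pow, ht2 w hw]; exact mo_lt hna1 (hO' _ (h2 w hw))
      nlinarith [norm_nonneg (τ w)]
    have hgm : ∀ y ∈ closedBall x e, g x y ∈ ball (0:ℂ) 1 := by
      intro y hy
      have := hg.small x y hy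
      simp only [mem_ball, dist_zero_right]
      linarith
    have hsq : Set.EqOn (s ^ 2) ((fun y => τ (g x y)) ^ 2) (closedBall x e) := by
      intro y hy
      simp only [Pi.pow_apply]
      rw [hs, ht2 _ (hgm y hy), h3 y hy]
    have key : ∃ τ' : ℂ → ℂ, DifferentiableOn ℂ τ' (ball 0 1) ∧
        (∀ w ∈ ball (0:ℂ) 1, τ' w ^ 2 = mo (-a) (sg w)) ∧ (∀ w ∈ ball (0:ℂ) 1, ‖τ' w‖ < 1) ∧
        ∀ y ∈ closedBall x e, s y = τ' (g x y) := by
      have hcont : ContinuousOn (fun y => τ (g x y)) (closedBall x e) :=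
        ht1.continuousOn.comp (hg.cont x).continuousOn hgm
      rcases (closedBall_preconnected x hg.pos.le).eq_or_eq_neg_of_sq_eq
        hsc.continuousOn hcont hsq (fun {y} hy h => by
          have := hsq hy
          simp only [Pi.pow_apply] at this
          rw [h] at this
          exact hs0 y (by simpa using this)) with h | h
      · exact ⟨τ, ht1, ht2, ht3, fun y hy => h hy⟩
      · exact ⟨fun w => - τ w, ht1.neg, fun w hw => by simp [ht2 w hw],
          fun w hw => by simpa using ht3 w hw, fun y hy => h hy⟩
    obtain ⟨τ', k1, k2, k3, k4⟩ := key
    refine ⟨fun w => mo (-b) (τ' w), ?_, ?_, ?_⟩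
    · exact (mo_diff hnb1).comp k1 fun w hw => by simpa using k3 w hw
    · intro w hw
      refine ⟨mo_lt hnb1 (k3 w hw), ?_⟩
      rw [hpinv _ (sg w) (k3 w hw) (hO' _ (h2 w hw)) (k2 w hw)]
      exact h2 w hw
    · intro y hy
      simp only [k4 y hy]
  · intro r' hr' hq w hw
    have hwr : ‖w‖ < r' := by simpa using hw
    have hw1 : ‖w‖ < 1 := by linarith
    refine ⟨hw1, hr ?_⟩
    rw [mem_ball, dist_zero_right, blaschke hb1 hb2 hw1, norm_mul]
    have e1 := mo_sq hb1 hw1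
    have e2 := mo_sq hb1 (mo_lt hb1 hw1)
    have e3 : (1 - ρ ^ 2) * (1 - ρ) ≤ (1 - ‖w‖ ^ 2) * (1 - ‖b‖ ^ 2) := by
      apply mul_le_mul <;> nlinarith [norm_nonneg w]
    have e4 : (1 - ρ ^ 2) * (1 - ρ) / 4 * (1 - ρ) ≤ (1 - ‖mo b w‖ ^ 2) * (1 - ‖b‖ ^ 2) := by
      have : 0 ≤ (1 - ρ ^ 2) * (1 - ρ) := by apply mul_nonneg <;> nlinarith
      apply mul_le_mul <;> nlinarith
    have e5 : ‖mo b (mo b w)‖ ≤ √(1 - (1 - ρ ^ 2) * (1 - ρ) ^ 2 / 16) := by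
      apply Real.le_sqrt_of_sq_le
      nlinarith
    have e6 : 0 < √(1 - (1 - ρ ^ 2) * (1 - ρ) ^ 2 / 16) := by
      apply Real.sqrt_pos.2
      have : (1 - ρ ^ 2) * (1 - ρ) ^ 2 ≤ 1 * 1 := by
        apply mul_le_mul <;> nlinarith
      linarith
    calc ‖w‖ * ‖mo b (mo b w)‖ ≤ ‖w‖ * √(1 - (1 - ρ ^ 2) * (1 - ρ) ^ 2 / 16) :=
          mul_le_mul_of_nonneg_left e5 (norm_nonneg _)
      _ < r' * √(1 - (1 - ρ ^ 2) * (1 - ρ) ^ 2 / 16) := mul_lt_mul_of_pos_right hwr e6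
      _ ≤ r := by linarith
  · rintro ⟨H, Hc, H0, H1, Hb, HO⟩
    have p0 : mo a (mo b 0 ^ 2) = 0 := by
      rw [mo_zero, hb2]; simp [mo]
    refine ⟨fun p => mo a (mo b (H p) ^ 2), ?_, ?_, ?_, ?_, fun p => (HO p).2⟩
    · exact mo_cont ha1 ((mo_cont hb1 Hc fun p => (HO p).1).pow 2) fun p => hsq1 _ (HO p).1
    · intro y
      simp only [H0]
      exact hpinv _ _ (hs1 y) (hO' _ (hFO y)) (hs y)
    · intro y; simp only [H1, p0]
    · intro t y hy; simp only [Hb t y hy, p0]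

lemma good_null {k : ℕ} (hk : 2 ≤ k) {g : (Fin k → I) → (Fin k → I) → ℂ} {e : ℝ}
    (hg : GOK g e) {ρ : ℝ} (hρ0 : 0 < ρ) (hρ : ρ < 1)
    (hbd : ∀ (O : Set ℂ) (F : (Fin k → I) → ℂ), O ⊆ ball 0 1 → Good g e O F → ∀ y, ‖F y‖ < ρ)
    (j : ℕ) : ∀ (O : Set ℂ) (F : (Fin k → I) → ℂ), O ⊆ ball 0 1 → Good g e O F →
    ball 0 (√(1 - (1 - ρ ^ 2) * (1 - ρ) ^ 2 / 16) ^ j * ρ) ⊆ O → Null O F 0 := by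
  set q := √(1 - (1 - ρ ^ 2) * (1 - ρ) ^ 2 / 16) with hq
  have hq0 : 0 ≤ q := Real.sqrt_nonneg _
  have hq1 : q ≤ 1 := by
    apply Real.sqrt_le_one.2
    have : 0 ≤ (1 - ρ ^ 2) * (1 - ρ) ^ 2 := by
      apply mul_nonneg <;> nlinarith
    linarith
  have base : ∀ (O : Set ℂ) (F : (Fin k → I) → ℂ), O ⊆ ball 0 1 → Good g e O F →
      ball 0 ρ ⊆ O → Null O F 0 := by
    intro O F hO hF hr
    have hb := hbd O F hO hF
    obtain ⟨hFc, hFb, -⟩ := hF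
    refine ⟨fun p => ((1 - (p.1:ℝ) : ℝ) : ℂ) * F p.2, by fun_prop, by simp, by simp,
      fun t y hy => by simp [hFb y hy], fun p => hr ?_⟩
    rw [mem_ball, dist_zero_right, norm_mul, Complex.norm_real, Real.norm_eq_abs,
      abs_of_nonneg (by linarith [p.1.2.2])]
    nlinarith [p.1.2.1, hb p.2, norm_nonneg (F p.2)]
  induction j with
  | zero => intro O F hO hF hr; exact base O F hO hF (by simpa using hr)
  | succ j ih =>
    intro O F hO hF hr
    by_cases hcase : ball 0 ρ ⊆ O
    · exact base O F hO hF hcase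
    · obtain ⟨a, ha, haO⟩ := Set.not_subset.1 hcase
      obtain ⟨O', F', h1, h2, h3, h4⟩ := step hk hg hO hF hρ haO (by simpa using ha) hr
      refine h4 (ih O' F' h1 h2 (h3 _ ?_ ?_))
      · exact mul_le_of_le_one_left hρ0.le (pow_le_one₀ hq0 hq1)
      · rw [← hq]; exact le_of_eq (by ring)


lemma open_null {k : ℕ} (hk : 2 ≤ k) {O : Set ℂ} (hO : IsOpen O) {f : (Fin k → I) → ℂ}
    (hf : Continuous f) (hfO : ∀ y, f y ∈ O) {c : ℂ}
    (hc : ∀ y ∈ Cube.boundary (Fin k), f y = c) : Null O f c := by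
  have z0 : (0 : Fin k → I) ∈ Cube.boundary (Fin k) := ⟨⟨0, by omega⟩, Or.inl rfl⟩
  have hcomp : IsCompact (Set.range f) := isCompact_range hf
  obtain ⟨R, hR0, hR⟩ := hcomp.isBounded.subset_ball_lt 0 c
  obtain ⟨d, hd0, hd⟩ := hcomp.exists_thickening_subset_open (hO.inter (isOpen_ball (x := c) (ε := R)))
    (fun z hz => by
      refine ⟨?_, hR hz⟩
      obtain ⟨y, rfl⟩ := hz
      exact hfO y)
  have hd' : ∀ y, ∀ w : ℂ, ‖w‖ < 1 → f y + d * w ∈ O ∧ ‖f y + d * w - c‖ < R := by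
    intro y w hw
    have : f y + d * w ∈ O ∩ ball c R := by
      apply hd
      rw [mem_thickening_iff]
      refine ⟨f y, ⟨y, rfl⟩, ?_⟩
      rw [dist_eq_norm, add_sub_cancel_left, norm_mul, Complex.norm_real, Real.norm_eq_abs,
        abs_of_pos hd0]
      nlinarith
    exact ⟨this.1, by simpa [dist_eq_norm] using this.2⟩
  have hu := CompactSpace.uniformContinuous_of_continuous hf
  obtain ⟨e, he0, he⟩ := Metric.uniformContinuous_iff.1 hu (d / 2) (by positivity)
  obtain ⟨N, hN⟩ := exists_nat_one_div_lt (show 0 < e / 2 by positivity)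
  have hRc : (R : ℂ) ≠ 0 := by exact_mod_cast hR0.ne'
  have hdc : (d : ℂ) ≠ 0 := by exact_mod_cast hd0.ne'
  let g : (Fin k → I) → (Fin k → I) → ℂ := fun x y => (f y - f x) / d
  have hg : GOK g (e / 2) := by
    refine ⟨by positivity, by simp [g], fun x => by fun_prop, fun x y hy => ?_⟩
    have h1 : dist y x < e := lt_of_le_of_lt hy (by linarith)
    have h2 := he h1
    rw [dist_eq_norm] at h2
    simp only [g, norm_div, Complex.norm_real, Real.norm_eq_abs, abs_of_pos hd0]
    rw [div_le_iff₀ hd0]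
    linarith
  let O' : Set ℂ := {w | ‖w‖ < 1 ∧ c + R * w ∈ O}
  have hO' : O' ⊆ ball 0 1 := fun w hw => by simpa using hw.1
  have hmemO : ∀ y, ∀ w : ℂ, ‖w‖ < 1 → (f y - c) / R + d / R * w ∈ O' := by
    intro y w hw
    obtain ⟨h1, h2⟩ := hd' y w hw
    constructor
    · have : (f y - c) / R + d / R * w = (f y + d * w - c) / R := by field_simp; ring
      rw [this, norm_div, Complex.norm_real, Real.norm_eq_abs, abs_of_pos hR0, div_lt_one hR0]
      exact h2
    · have : c + R * ((f y - c) / R + d / R * w) = f y + d * w := by field_simp; ring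
      rw [this]
      exact h1
  have hF : Good g (e / 2) O' fun y => (f y - c) / R := by
    refine ⟨by fun_prop, fun y hy => by simp [hc y hy], fun x =>
      ⟨fun w => (f x - c) / R + d / R * w, by fun_prop,
        fun w hw => hmemO x w (by simpa using hw), fun y _ => ?_⟩⟩
    simp only [g]
    field_simp
    ring
  set A : ℝ := (3/16) ^ (N + 1) with hA
  have hA0 : 0 < A := by positivity
  have hA1 : A < 1 := pow_lt_one₀ (by norm_num) (by norm_num) (by omega)
  have hρ0 : 0 < √(1 - A / 2) := Real.sqrt_pos.2 (by linarith)
  have hρ1 : √(1 - A / 2) < 1 := by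
    rw [Real.sqrt_lt' one_pos]; linarith
  have hbd : ∀ (O : Set ℂ) (F : (Fin k → I) → ℂ), O ⊆ ball 0 1 → Good g (e/2) O F →
      ∀ y, ‖F y‖ < √(1 - A / 2) := by
    intro O F h1 h2 y
    apply Real.lt_sqrt_of_sq_lt
    have := h2.bound hk hg (N := N + 1) (by omega) (by push_cast; exact hN.le) h1 y
    linarith
  set ρ := √(1 - A / 2) with hρ
  have hq1 : √(1 - (1 - ρ ^ 2) * (1 - ρ) ^ 2 / 16) < 1 := by
    rw [Real.sqrt_lt' one_pos]
    have : 0 < (1 - ρ ^ 2) * (1 - ρ) ^ 2 := by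
      apply mul_pos
      · nlinarith
      · exact pow_pos (by linarith) 2
    linarith
  obtain ⟨j, hj⟩ := exists_pow_lt_of_lt_one (show 0 < d / R by positivity) hq1
  obtain ⟨H, Hc, H0, H1, Hb, HO⟩ := good_null hk hg hρ0 hρ1 hbd j O' _ hO' hF (by
    intro w hw
    have hw : ‖w‖ < √(1 - (1 - ρ ^ 2) * (1 - ρ) ^ 2 / 16) ^ j * ρ := by simpa using hw
    have hw2 : ‖w‖ < d / R := by
      have : 0 ≤ √(1 - (1 - ρ ^ 2) * (1 - ρ) ^ 2 / 16) ^ j := pow_nonneg (Real.sqrt_nonneg _) _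
      nlinarith
    have := hmemO 0 (R / d * w) (by
      rw [norm_mul, norm_div, Complex.norm_real, Complex.norm_real, Real.norm_eq_abs,
        Real.norm_eq_abs, abs_of_pos hR0, abs_of_pos hd0]
      rw [lt_div_iff₀ hR0] at hw2
      rw [div_mul_eq_mul_div, div_lt_one hd0]
      linarith)
    rw [hc 0 z0] at this
    convert! this using 1
    field_simp
    ring)
  refine ⟨fun p => c + R * H p, by fun_prop, fun y => ?_, fun y => by simp [H1],
    fun t y hy => by simp [Hb t y hy], fun p => (HO p).2⟩
  simp only [H0]
  field_simp
  ring

lemma homotopic_mk {k : ℕ} {X : Type*} [TopologicalSpace X] {x : X} (f g : GenLoop (Fin k) X x)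
    (H : I × (Fin k → I) → X) (hc : Continuous H) (h0 : ∀ y, H (0, y) = f y)
    (h1 : ∀ y, H (1, y) = g y) (hb : ∀ t, ∀ y ∈ Cube.boundary (Fin k), H (t, y) = x) :
    GenLoop.Homotopic f g :=
  ⟨{ toFun := H
     continuous_toFun := hc
     map_zero_left := h0
     map_one_left := h1
     prop' := fun t y hy => (hb t y hy).trans (f.2 y hy).symm }⟩

abbrev CF (n : ℕ) := {f : Fin n → ℂ // Function.Injective f}

/-- drop the zeroth point -/
def tl {n : ℕ} (f : CF (n + 1)) : CF n :=
  ⟨fun i => f.1 i.succ, fun i j h => Fin.succ_injective _ (f.2 h)⟩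

lemma ev_cont {X : Type*} [TopologicalSpace X] {n : ℕ} {b : X → CF n} (hb : Continuous b)
    (i : Fin n) : Continuous fun x => (b x).1 i :=
  (continuous_apply i).comp (continuous_subtype_val.comp hb)

lemma tl_cont {n : ℕ} : Continuous (tl (n := n)) :=
  Continuous.subtype_mk (f := fun (g : CF (n + 1)) (i : Fin n) => g.1 i.succ)
    (continuous_pi fun i : Fin n => ev_cont continuous_id i.succ) _

/-- add a zeroth point -/
def cn {n : ℕ} (b : CF n) (z : ℂ) (h : ∀ i, z ≠ b.1 i) : CF (n + 1) :=
  ⟨Fin.cons z b.1, Fin.cons_injective_iff.2 ⟨fun ⟨i, hi⟩ => h i hi.symm, b.2⟩⟩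

lemma cn_cont {X : Type*} [TopologicalSpace X] {n : ℕ} {b : X → CF n} {z : X → ℂ}
    (h : ∀ x i, z x ≠ (b x).1 i) (hb : Continuous b) (hz : Continuous z) :
    Continuous fun x => cn (b x) (z x) (h x) := by
  apply Continuous.subtype_mk
  refine continuous_pi fun i => ?_
  refine Fin.cases ?_ (fun i => ?_) i
  · simpa using hz
  · simp only [Fin.cons_succ]; exact ev_cont hb i

lemma cn_tl {n : ℕ} {b : CF n} {z : ℂ} (h : ∀ i, z ≠ b.1 i) (f : CF (n + 1)) (hb : b = tl f)
    (hz : z = f.1 0) : cn b z h = f := by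
  subst hb hz
  apply Subtype.ext
  funext i
  refine Fin.cases ?_ (fun i => ?_) i <;> simp [cn, tl]

lemma tl_cn {n : ℕ} {b : CF n} {z : ℂ} (h : ∀ i, z ≠ b.1 i) : tl (cn b z h) = b := by
  apply Subtype.ext
  funext i
  simp [cn, tl]

lemma ne_tl {n : ℕ} (f : CF (n + 1)) (i : Fin n) : f.1 0 ≠ (tl f).1 i := fun h =>
  (Fin.succ_ne_zero i) (f.2 h).symm

/-- moves the plane, carrying `b` to `b'` -/
noncomputable def tr {n : ℕ} (e : ℝ) (b b' : Fin n → ℂ) (z : ℂ) : ℂ :=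
  z + ∑ j, ((max 0 (1 - ‖z - b j‖ / e) : ℝ) : ℂ) * (b' j - b j)

lemma tr_self {n : ℕ} (e : ℝ) (b : Fin n → ℂ) (z : ℂ) : tr e b b z = z := by simp [tr]

lemma tr_cont {X : Type*} [TopologicalSpace X] {n : ℕ} (e : ℝ) {b b' : X → Fin n → ℂ}
    {z : X → ℂ} (hb : Continuous b) (hb' : Continuous b') (hz : Continuous z) :
    Continuous fun x => tr e (b x) (b' x) (z x) := by
  unfold tr
  fun_prop

lemma tr_ne {n : ℕ} {e : ℝ} (he : 0 < e) {b b' : Fin n → ℂ}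
    (hsep : ∀ i j, i ≠ j → e ≤ ‖b i - b j‖) (hcl : ∀ i, ‖b' i - b i‖ ≤ e / (2 * (n + 1)))
    {z : ℂ} {i : Fin n} (hz : z ≠ b i) : tr e b b' z ≠ b' i := by
  have h1 : tr e b b' (b i) = b' i := by
    unfold tr
    rw [Finset.sum_eq_single i]
    · simp
    · intro j _ hj
      have := hsep i j hj.symm
      have h2 : 1 - ‖b i - b j‖ / e ≤ 0 := by
        rw [sub_nonpos, le_div_iff₀ he]; linarith
      simp [max_eq_left h2]
    · simp
  rw [← h1]
  intro h
  have h3 : z - b i = ∑ j, (((max 0 (1 - ‖b i - b j‖ / e) : ℝ) : ℂ)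
      - ((max 0 (1 - ‖z - b j‖ / e) : ℝ) : ℂ)) * (b' j - b j) := by
    simp only [sub_mul, Finset.sum_sub_distrib]
    unfold tr at h
    linear_combination h
  have hpos : 0 < ‖z - b i‖ := norm_pos_iff.2 (sub_ne_zero.2 hz)
  have h4 : ‖z - b i‖ ≤ ∑ j : Fin n, ‖z - b i‖ / (2 * (n + 1)) := by
    conv_lhs => rw [h3]
    refine (norm_sum_le _ _).trans (Finset.sum_le_sum fun j _ => ?_)
    rw [norm_mul, ← Complex.ofReal_sub, Complex.norm_real, Real.norm_eq_abs]
    have a1 : |max 0 (1 - ‖b i - b j‖ / e) - max 0 (1 - ‖z - b j‖ / e)| ≤ ‖z - b i‖ / e := by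
      refine (abs_max_sub_max_le_max _ _ _ _).trans ?_
      have : 1 - ‖b i - b j‖ / e - (1 - ‖z - b j‖ / e) = (‖z - b j‖ - ‖b i - b j‖) / e := by ring
      rw [this, abs_div, abs_of_pos he, sub_zero, abs_zero]
      apply max_le (by positivity)
      gcongr
      refine (abs_norm_sub_norm_le _ _).trans ?_
      simp
    calc _ ≤ ‖z - b i‖ / e * (e / (2 * (n + 1))) :=
          mul_le_mul a1 (hcl j) (norm_nonneg _) (by positivity)
      _ = _ := by field_simp
  rw [Finset.sum_const, Finset.card_univ, Fintype.card_fin, nsmul_eq_mul] at h4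
  have hn : (0:ℝ) ≤ n := Nat.cast_nonneg n
  rw [mul_div_assoc', le_div_iff₀ (by positivity)] at h4
  nlinarith

lemma conf_null {k : ℕ} (hk : 2 ≤ k) : ∀ n : ℕ, ∀ x : CF n, ∀ f : GenLoop (Fin k) (CF n) x,
    GenLoop.Homotopic f GenLoop.const := by
  intro n
  induction n with
  | zero =>
    intro x f
    have : f = GenLoop.const := by
      ext y i
      exact i.elim0
    rw [this]
  | succ n ih =>
    intro x f
    have hbf : ∀ (f : GenLoop (Fin k) (CF (n+1)) x), ∀ y ∈ Cube.boundary (Fin k), f y = x :=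
      fun f => f.2
    have hcf : ∀ (f : GenLoop (Fin k) (CF (n+1)) x), Continuous f := fun f => f.1.continuous
    obtain ⟨H⟩ := ih (tl x) ⟨⟨fun y => tl (f y), tl_cont.comp (hcf f)⟩,
      fun y hy => congrArg tl (hbf f y hy)⟩
    have H0 : ∀ y, H (0, y) = tl (f y) := fun y => H.map_zero_left y
    have H1 : ∀ y, H (1, y) = tl x := fun y => H.map_one_left y
    have Hb : ∀ t, ∀ y ∈ Cube.boundary (Fin k), H (t, y) = tl x := fun t y hy =>
      (H.prop' t y hy).trans (congrArg tl (hbf f y hy))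
    have Hc : Continuous H := H.continuous
    -- uniform separation
    obtain ⟨e, hesep, he⟩ : ∃ e : ℝ, (∀ q : Fin n × Fin n, q.1 ≠ q.2 → ∀ p,
        e ≤ ‖(H p).1 q.1 - (H p).1 q.2‖) ∧ 0 < e := by
      have : ∀ᶠ e : ℝ in 𝓝[>] 0, ∀ q : Fin n × Fin n, q.1 ≠ q.2 → ∀ p,
          e ≤ ‖(H p).1 q.1 - (H p).1 q.2‖ := by
        rw [Filter.eventually_all]
        intro q
        by_cases hq : q.1 = q.2
        · exact Filter.Eventually.of_forall fun e h => absurd hq h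
        have hcont : Continuous fun p => ‖(H p).1 q.1 - (H p).1 q.2‖ :=
          ((ev_cont Hc q.1).sub (ev_cont Hc q.2)).norm
        obtain ⟨p0, -, hp0⟩ := isCompact_univ.exists_isMinOn
          ⟨((0 : I), (0 : Fin k → I)), trivial⟩ hcont.continuousOn
        have hpos : 0 < ‖(H p0).1 q.1 - (H p0).1 q.2‖ :=
          norm_pos_iff.2 (sub_ne_zero.2 fun h => hq ((H p0).2 h))
        filter_upwards [nhdsWithin_le_nhds (Iio_mem_nhds hpos)] with e he _ p
        exact le_trans (le_of_lt he) (hp0 (Set.mem_univ p))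
      exact (this.and self_mem_nhdsWithin).exists
    have hu := CompactSpace.uniformContinuous_of_continuous
      (f := fun p => (H p).1) (by fun_prop)
    obtain ⟨d, hd0, hd⟩ := Metric.uniformContinuous_iff.1 hu (e / (2 * (n + 1))) (by positivity)
    obtain ⟨N, hN⟩ := exists_nat_one_div_lt hd0
    have hN0 : (0:ℝ) < N + 1 := by positivity
    let tt : ℝ → I := fun r => Set.projIcc 0 1 zero_le_one (r / (N + 1))
    have ttc : Continuous tt := continuous_projIcc.comp (by fun_prop)
    have main : ∀ i : ℕ, ∃ f' : GenLoop (Fin k) (CF (n+1)) x, GenLoop.Homotopic f f' ∧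
        ∀ y, tl (f' y) = H (tt i, y) := by
      intro i
      induction i with
      | zero =>
        refine ⟨f, GenLoop.Homotopic.refl f, fun y => ?_⟩
        have : tt ((0:ℕ):ℝ) = 0 := by simp [tt]
        rw [this, H0]
      | succ i ih2 =>
        obtain ⟨f', hf', hft⟩ := ih2
        have f'c := hcf f'
        have hne : ∀ (p : I × (Fin k → I)) (j : Fin n),
            tr e (H (tt i, p.2)).1 (H (tt (i + p.1), p.2)).1 ((f' p.2).1 0) ≠
              (H (tt (i + p.1), p.2)).1 j := by
          intro p j
          apply tr_ne he (fun a b hab => hesep (a, b) hab _)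
          · intro a
            rw [← dist_eq_norm]
            refine (dist_le_pi_dist (H (tt (i + p.1), p.2)).1 (H (tt i, p.2)).1 a).trans
              (hd ?_).le
            rw [Prod.dist_eq, dist_self, max_eq_left dist_nonneg, Subtype.dist_eq, Real.dist_eq]
            refine (Set.abs_projIcc_sub_projIcc (a := (0:ℝ)) (b := 1) (c := ((i:ℝ) + p.1) / (N + 1)) (d := (i:ℝ) / (N + 1))
              zero_le_one).trans_lt (lt_of_le_of_lt ?_ hN)
            have : ((i:ℝ) + p.1) / (N + 1) - i / (N + 1) = p.1 / (N + 1) := by ring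
            rw [this, abs_of_nonneg (div_nonneg p.1.2.1 hN0.le)]
            exact div_le_div_of_nonneg_right p.1.2.2 hN0.le
          · rw [← hft]
            exact ne_tl _ _
        let G : I × (Fin k → I) → CF (n+1) := fun p => cn (H (tt (i + p.1), p.2)) _ (hne p)
        have Gc : Continuous G := by
          apply cn_cont
          · fun_prop
          · exact tr_cont e (by fun_prop) (by fun_prop) (ev_cont (f'c.comp continuous_snd) 0)
        have Gb : ∀ t, ∀ y ∈ Cube.boundary (Fin k), G (t, y) = x := by
          intro t y hy
          apply cn_tl
          · exact Hb _ y hy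
          · simp only [Hb _ y hy, tr_self, hbf f' y hy]
        refine ⟨⟨⟨fun y => G (1, y), by fun_prop⟩, fun y hy => Gb 1 y hy⟩, hf'.trans ?_, ?_⟩
        · refine homotopic_mk _ _ G Gc (fun y => ?_) (fun y => rfl) Gb
          apply cn_tl
          · simp [hft]
          · simp [tr_self]
        · intro y
          refine (tl_cn (hne (1, y))).trans ?_
          simp
    obtain ⟨f', hf', hft⟩ := main (N + 1)
    refine hf'.trans ?_
    have f'c := hcf f'
    have t1 : tt ((N + 1 : ℕ) : ℝ) = 1 := by
      simp only [tt]
      push_cast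
      rw [div_self hN0.ne']
      exact Set.projIcc_right _
    rw [t1] at hft
    have hft' : ∀ y, tl (f' y) = tl x := fun y => (hft y).trans (H1 y)
    obtain ⟨L, Lc, L0, L1, Lb, LO⟩ := open_null hk (O := {z | ∀ j, z ≠ (tl x).1 j})
      (by
        have : {z : ℂ | ∀ j, z ≠ (tl x).1 j} = (Set.range (tl x).1)ᶜ := by
          ext z
          simp [eq_comm]
        rw [this]
        exact (Set.finite_range _).isClosed.isOpen_compl)
      (f := fun y => (f' y).1 0) (ev_cont f'c 0) (fun y j => by rw [← hft' y]; exact ne_tl _ _)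
      (c := x.1 0) (fun y hy => by simp only [hbf f' y hy])
    refine homotopic_mk _ _ (fun p => cn (tl x) (L p) (LO p)) (cn_cont LO continuous_const Lc) ?_ ?_ ?_
    · intro y
      exact cn_tl (LO (0, y)) _ (hft' y).symm (L0 y)
    · intro y
      exact cn_tl (LO (1, y)) _ rfl (L1 y)
    · intro t y hy
      exact cn_tl (LO (t, y)) _ rfl (Lb t y hy)

lemma conf_path (n : ℕ) : PathConnectedSpace (CF n) := by
  refine ⟨⟨⟨fun i => ((i : ℕ) : ℂ), fun i j h => Fin.ext (by
    have h2 : ((i : ℕ) : ℂ) = ((j : ℕ) : ℂ) := h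
    exact_mod_cast h2)⟩⟩, fun x y => ?_⟩
  let L : ℂ → Fin n → ℂ := fun t i => x.1 i + t * (y.1 i - x.1 i)
  have Lc : Continuous L := by fun_prop
  let S : Set ℂ := ⋃ q : Fin n × Fin n, {t | q.1 ≠ q.2 ∧ L t q.1 = L t q.2}
  have hS : S.Countable := by
    apply Set.countable_iUnion
    intro q
    apply Set.Subsingleton.countable
    rintro s ⟨hq, hs⟩ t ⟨-, ht⟩
    simp only [L] at hs ht
    by_contra hst
    have h1 : (s - t) * ((y.1 q.1 - x.1 q.1) - (y.1 q.2 - x.1 q.2)) = 0 := by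
      linear_combination hs - ht
    have h2 := (mul_eq_zero.1 h1).resolve_left (sub_ne_zero.2 hst)
    exact hq (x.2 (by linear_combination hs - s * h2))
  have inj : ∀ t ∈ Sᶜ, Function.Injective (L t) := by
    intro t ht i j hij
    by_contra h
    exact ht (Set.mem_iUnion.2 ⟨(i, j), h, hij⟩)
  have mem : ∀ t, Function.Injective (L t) → t ∈ Sᶜ := by
    intro t ht h
    obtain ⟨q, h1, h2⟩ := Set.mem_iUnion.1 h
    exact h1 (ht h2)
  have hP := hS.isPathConnected_compl_of_one_lt_rank (E := ℂ) (by
    rw [Complex.rank_real_complex]; norm_num)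
  have L0 : L 0 = x.1 := by funext i; simp [L]
  have L1 : L 1 = y.1 := by funext i; simp [L]
  obtain ⟨γ, hγ⟩ := hP.joinedIn 0 (mem _ (L0 ▸ x.2)) 1 (mem _ (L1 ▸ y.2))
  exact ⟨{ toFun := fun t => ⟨L (γ t), inj _ (hγ t)⟩
           continuous_toFun := by fun_prop
           source' := Subtype.ext (by simp [L0])
           target' := Subtype.ext (by simp [L1]) }⟩

end ConfAux

/-- The ordered configuration space `Conf_n(ℂ)` is path-connected and aspherical:
`π_k` is trivial for all `k ≥ 2`.  (This is the homotopy-theoretic content of the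
fact that `Conf_n(ℂ)` is a classifying space for the pure braid group `PB_n`.) -/
theorem Conf_pathConnected_and_aspherical (n : ℕ) (hn : 1 ≤ n) :
    PathConnectedSpace (Conf n) ∧
    (∀ k : ℕ, 2 ≤ k → ∀ x : Conf n, Subsingleton (HomotopyGroup (Fin k) (Conf n) x)) := by
  refine ⟨ConfAux.conf_path n, fun k hk x => ⟨fun a b => ?_⟩⟩
  refine Quotient.inductionOn₂ a b fun f g => ?_
  exact Quotient.sound ((ConfAux.conf_null hk n x f).trans (ConfAux.conf_null hk n x g).symm)
end
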